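/- Let F be a field of characteristic different from two, and let q be a form over F whose Witt class lies in Iⁿ(F), the n-th power of the fundamental ideal of the Witt ring W(F). If dim q < 2ⁿ, then q is hyperbolic; if dim q = 2ⁿ, then q is similar to an n-fold Pfister form. -/

import Mathlib

set_option synthInstance.maxHeartbeats 1000000
set_option maxHeartbeats 4000000

open scoped BigOperators Classical

namespace QF

section Defs

variable {R : Type*} [CommRing R]

/-- Evaluation of the diagonal quadratic form with coefficients `d` at the vector `v`. -/
def evalQF {n : ℕ} (d : Fin n → R) (v : Fin n → R) : R := ∑ i, d i * v i ^ 2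

/-- A form is isotropic if it represents zero non-trivially. -/
def Isotropic {n : ℕ} (d : Fin n → R) : Prop := ∃ v : Fin n → R, v ≠ 0 ∧ evalQF d v = 0

def Anisotropic {n : ℕ} (d : Fin n → R) : Prop := ¬ Isotropic d

/-- Nondegeneracy of a diagonal form: all coefficients are nonzero. -/
def Nondeg {n : ℕ} (d : Fin n → R) : Prop := ∀ i, d i ≠ 0

/-- Two diagonal forms are isometric if a linear equivalence matches their values. -/
def Isometric {m n : ℕ} (d : Fin m → R) (e : Fin n → R) : Prop :=
  ∃ φ : (Fin m → R) ≃ₗ[R] (Fin n → R), ∀ v, evalQF e (φ v) = evalQF d v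

/-- Orthogonal sum of diagonal forms. -/
def osum {m n : ℕ} (d : Fin m → R) (e : Fin n → R) : Fin (m + n) → R := Fin.append d e

/-- Tensor product of diagonal forms. -/
def tensorQF {m n : ℕ} (d : Fin m → R) (e : Fin n → R) : Fin (m * n) → R :=
  fun i => d (finProdFinEquiv.symm i).1 * e (finProdFinEquiv.symm i).2

/-- Scaling of a form by a scalar. -/
def smulQF {n : ℕ} (a : R) (d : Fin n → R) : Fin n → R := fun i => a * d i

/-- `k` copies of the hyperbolic plane `⟨1,-1⟩`. -/
def hypform {R : Type*} [CommRing R] (k : ℕ) : Fin (k + k) → R :=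
  Fin.append (fun _ => 1) (fun _ => -1)

/-- A form is hyperbolic if it is isometric to a sum of hyperbolic planes,
i.e. its Witt index is half its dimension. -/
def IsHyperbolic {n : ℕ} (d : Fin n → R) : Prop := ∃ k : ℕ, Isometric d (hypform k)

/-- The Witt index: the largest `k` such that `d ≅ k×⟨1,-1⟩ ⊥ r`. -/
noncomputable def WittIndex {n : ℕ} (d : Fin n → R) : ℕ :=
  sSup {k : ℕ | ∃ (m : ℕ) (r : Fin m → R), Isometric d (osum (hypform k) r)}

/-- `r` is a subform of `d`: `d ≅ r ⊥ s` for some (nondegenerate) form `s`. -/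
def Subform {m n : ℕ} (r : Fin m → R) (d : Fin n → R) : Prop :=
  ∃ (k : ℕ) (s : Fin k → R), Nondeg s ∧ Isometric d (osum r s)

/-- The set of nonzero represented values. -/
def Dset {n : ℕ} (d : Fin n → R) : Set R :=
  {a | a ≠ 0 ∧ ∃ v : Fin n → R, evalQF d v = a}

/-- The group of similarity factors `G(q) = {a : a·q ≅ q}`. -/
def Gset {n : ℕ} (d : Fin n → R) : Set R :=
  {a | a ≠ 0 ∧ Isometric (smulQF a d) d}

/-- `H(q) = {a : ⟨1,-a⟩ ⊗ q is isotropic}`. -/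
def Hset {n : ℕ} (d : Fin n → R) : Set R :=
  {a | a ≠ 0 ∧ Isotropic (tensorQF ![1, -a] d)}

/-- Base change of a form along a ring homomorphism (e.g. a field extension). -/
def bc {S : Type*} [CommRing S] (f : R →+* S) {n : ℕ} (d : Fin n → R) : Fin n → S :=
  fun i => f (d i)

/-- The Pfister form `⟨1,a 0⟩ ⊗ ⋯ ⊗ ⟨1, a (n-1)⟩`: its `2^n` diagonal coefficients are
the products `∏_{j ∈ S} a j` over subsets `S` of the index set. -/
noncomputable def pfisterOf {n : ℕ} (a : Fin n → R) : Fin (2 ^ n) → R :=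
  fun i => ∏ j : Fin n, if (finFunctionFinEquiv.symm i) j = 0 then 1 else a j

/-- `π` is an `n`-fold Pfister form. -/
def IsNPfister (n : ℕ) {m : ℕ} (π : Fin m → R) : Prop :=
  ∃ a : Fin n → R, (∀ i, a i ≠ 0) ∧ Isometric π (pfisterOf a)

/-- `π` is a Pfister form. -/
def IsPfister {m : ℕ} (π : Fin m → R) : Prop := ∃ n : ℕ, IsNPfister n π

end Defs

/-- The quadric polynomial `p(X₁,…,Xₙ) = ∑ dᵢ Xᵢ²` attached to a diagonal form. -/
noncomputable def formPoly {F : Type*} [CommRing F] {n : ℕ} (d : Fin n → F) :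
    MvPolynomial (Fin n) F :=
  ∑ i, MvPolynomial.C (d i) * MvPolynomial.X i ^ 2

/-- The affine coordinate ring `F[X₁,…,Xₙ]/(p(X))` of the quadric `p = 0`. -/
abbrev CoordRing {F : Type*} [CommRing F] {n : ℕ} (d : Fin n → F) : Type _ :=
  MvPolynomial (Fin n) F ⧸ Ideal.span {formPoly d}

/-- The function field `F(p)` of the quadric `p = 0`: the total fraction ring of the
coordinate ring (the quotient field when the coordinate ring is a domain, i.e. when `p` is
anisotropic of dimension at least 2). -/
abbrev FunField {F : Type*} [Field F] {n : ℕ} (d : Fin n → F) : Type _ :=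
  FractionRing (CoordRing d)

end QF


namespace QF

/-- Witt equivalence of forms: the forms become isometric after adding hyperbolic planes. -/
def WittEquiv {F : Type*} [Field F] {m n : ℕ} (d : Fin m → F) (e : Fin n → F) : Prop :=
  ∃ a b : ℕ, Isometric (osum d (hypform a)) (osum e (hypform b))

/-- Forms which are orthogonal sums of `n`-fold Pfister forms and of negatives of `n`-fold
Pfister forms; their Witt classes are exactly the elements of `Iⁿ(F)`, the `n`-th power of the
fundamental ideal of the Witt ring, since `Iⁿ(F)` is additively generated by the classes of
`n`-fold Pfister forms. -/
inductive IsPfisterSum (F : Type*) [Field F] (n : ℕ) : ∀ {m : ℕ}, (Fin m → F) → Prop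
  | nil : IsPfisterSum F n (Fin.elim0 : Fin 0 → F)
  | pos {m k : ℕ} {d : Fin m → F} {π : Fin k → F} :
      IsPfisterSum F n d → IsNPfister n π → IsPfisterSum F n (osum d π)
  | neg {m k : ℕ} {d : Fin m → F} {π : Fin k → F} :
      IsPfisterSum F n d → IsNPfister n π → IsPfisterSum F n (osum d (smulQF (-1) π))

end QF

namespace ArasonPfister

universe u

section Bilinear

variable {R : Type*} [CommRing R] {ι κ : Type} [Fintype ι] [Fintype κ]

/-- The symmetric bilinear form attached to the diagonal form with coefficients `d`. -/
def bil (d : ι → R) (u v : ι → R) : R := ∑ i, d i * u i * v i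

lemma bil_comm (d u v : ι → R) : bil d u v = bil d v u := by
  simp only [bil, mul_right_comm]

lemma bil_add_left (d u v w : ι → R) : bil d (u + v) w = bil d u w + bil d v w := by
  simp only [bil, Pi.add_apply, mul_add, add_mul, Finset.sum_add_distrib]

lemma bil_add_right (d u v w : ι → R) : bil d u (v + w) = bil d u v + bil d u w := by
  simp only [bil, Pi.add_apply, mul_add, Finset.sum_add_distrib]

lemma bil_smul_left (d u v : ι → R) (c : R) : bil d (c • u) v = c * bil d u v := by
  simp only [bil, Pi.smul_apply, smul_eq_mul, Finset.mul_sum]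
  exact Finset.sum_congr rfl fun _ _ => by ring

lemma bil_smul_right (d u v : ι → R) (c : R) : bil d u (c • v) = c * bil d u v := by
  rw [bil_comm, bil_smul_left, bil_comm]

lemma bil_zero_left (d v : ι → R) : bil d 0 v = 0 := by simp [bil]

lemma bil_neg_left (d u v : ι → R) : bil d (-u) v = -bil d u v := by simp [bil]

lemma bil_neg_right (d u v : ι → R) : bil d u (-v) = -bil d u v := by simp [bil]

lemma bil_sub_left (d u v w : ι → R) : bil d (u - v) w = bil d u w - bil d v w := by
  rw [sub_eq_add_neg, bil_add_left, bil_neg_left, sub_eq_add_neg]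

lemma bil_sub_right (d u v w : ι → R) : bil d u (v - w) = bil d u v - bil d u w := by
  rw [sub_eq_add_neg, bil_add_right, bil_neg_right, sub_eq_add_neg]

lemma bil_single_right [DecidableEq ι] (d u : ι → R) (i : ι) :
    bil d u (Pi.single i 1) = d i * u i := by
  simp [bil, Pi.single_apply]

lemma bil_sumElim (d : ι → R) (e : κ → R) (u v : ι ⊕ κ → R) :
    bil (Sum.elim d e) u v =
      bil d (u ∘ Sum.inl) (v ∘ Sum.inl) + bil e (u ∘ Sum.inr) (v ∘ Sum.inr) := by
  simp [bil, Fintype.sum_sum_type]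

lemma bil_cons {n : ℕ} (a : R) (d : Fin n → R) (u v : Fin (n + 1) → R) :
    bil (Fin.cons a d : Fin (n + 1) → R) u v = a * u 0 * v 0 + bil d (Fin.tail u) (Fin.tail v) := by
  simp [bil, Fin.sum_univ_succ, Fin.tail]

lemma bil_succ {n : ℕ} (d u v : Fin (n + 1) → R) :
    bil d u v = d 0 * u 0 * v 0 + bil (Fin.tail d) (Fin.tail u) (Fin.tail v) := by
  simp [bil, Fin.sum_univ_succ, Fin.tail]

lemma bil_append {m n : ℕ} (d : Fin m → R) (e : Fin n → R) (u v : Fin m → R) (u' v' : Fin n → R) :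
    bil (Fin.append d e) (Fin.append u u') (Fin.append v v') = bil d u v + bil e u' v' := by
  simp [bil, Fin.sum_univ_add]

lemma map_bil {S : Type*} [CommRing S] (f : R →+* S) (d u v : ι → R) :
    f (bil d u v) = bil (fun i => f (d i)) (fun i => f (u i)) fun i => f (v i) := by
  simp only [bil, map_sum, map_mul]

end Bilinear

section Geometry

variable {F : Type u} [Field F]
variable {ι κ μ ν : Type} [Fintype ι] [Fintype κ] [Fintype μ] [Fintype ν]

/-- The radical of a diagonal form with nonzero coefficients is trivial. -/
lemma eq_zero_of_bil_eq_zero {d : ι → F} (hd : ∀ i, d i ≠ 0) {u : ι → F}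
    (h : ∀ v, bil d u v = 0) : u = 0 := by
  ext i
  have := h (Pi.single i 1)
  rw [bil_single_right] at this
  simpa [hd i] using this

/-- Isometry of diagonal forms over arbitrary finite index types. -/
def Iso (d : ι → F) (e : κ → F) : Prop :=
  ∃ φ : (ι → F) ≃ₗ[F] (κ → F), ∀ u v, bil e (φ u) (φ v) = bil d u v

lemma Iso.refl (d : ι → F) : Iso d d := ⟨LinearEquiv.refl _ _, fun _ _ => rfl⟩

lemma Iso.symm {d : ι → F} {e : κ → F} (h : Iso d e) : Iso e d := by
  obtain ⟨φ, hφ⟩ := h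
  exact ⟨φ.symm, fun u v => by rw [← hφ]; simp⟩

lemma Iso.trans {d : ι → F} {e : κ → F} {f : μ → F} (h : Iso d e) (h' : Iso e f) : Iso d f := by
  obtain ⟨φ, hφ⟩ := h
  obtain ⟨ψ, hψ⟩ := h'
  exact ⟨φ.trans ψ, fun u v => by simp [hψ, hφ]⟩

lemma Iso.card_eq {d : ι → F} {e : κ → F} (h : Iso d e) : Fintype.card ι = Fintype.card κ := by
  obtain ⟨φ, -⟩ := h
  simpa using φ.finrank_eq

lemma Iso.scale {d : ι → F} {e : κ → F} (h : Iso d e) (a : F) :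
    Iso (fun i => a * d i) (fun i => a * e i) := by
  obtain ⟨φ, hφ⟩ := h
  refine ⟨φ, fun u v => ?_⟩
  have key : ∀ {ι : Type} [Fintype ι] (d u v : ι → F),
      bil (fun i => a * d i) u v = a * bil d u v := by
    intro ι _ d u v
    simp only [bil, Finset.mul_sum, mul_assoc]
  rw [key, key, hφ]

lemma Iso.sum {d : ι → F} {e : κ → F} {d' : μ → F} {e' : ν → F} (h : Iso d e) (h' : Iso d' e') :
    Iso (Sum.elim d d') (Sum.elim e e') := by
  obtain ⟨φ, hφ⟩ := h
  obtain ⟨ψ, hψ⟩ := h'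
  refine ⟨(LinearEquiv.sumArrowLequivProdArrow ι μ F F).trans
    ((φ.prodCongr ψ).trans (LinearEquiv.sumArrowLequivProdArrow κ ν F F).symm), fun u v => ?_⟩
  rw [bil_sumElim, bil_sumElim, ← hφ, ← hψ]
  rfl

lemma Iso.reindex (e : κ → F) (σ : ι ≃ κ) : Iso (e ∘ σ) e := by
  refine ⟨LinearEquiv.funCongrLeft F F σ.symm, fun u v => ?_⟩
  simp only [bil]
  rw [← Equiv.sum_comp σ]
  simp [LinearEquiv.funCongrLeft]

lemma Iso.ne_zero {d : ι → F} {e : κ → F} (h : Iso d e) (he : ∀ i, e i ≠ 0) (i : ι) : d i ≠ 0 := by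
  intro h0
  obtain ⟨φ, hφ⟩ := h
  have h1 : φ (Pi.single i 1) = 0 := by
    refine eq_zero_of_bil_eq_zero he fun v => ?_
    obtain ⟨w, rfl⟩ := φ.surjective v
    rw [hφ, bil_comm, bil_single_right, h0, zero_mul]
  rw [map_eq_zero_iff _ φ.injective] at h1
  simpa using congr_fun h1 i

/-- A linear map preserving bilinear forms between forms of the same dimension is an isometry
as soon as the source is nondegenerate. -/
lemma Iso.of_linearMap {d : ι → F} {e : κ → F} (hd : ∀ i, d i ≠ 0)
    (hc : Fintype.card ι = Fintype.card κ) (ψ : (ι → F) →ₗ[F] (κ → F))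
    (hψ : ∀ u v, bil e (ψ u) (ψ v) = bil d u v) : Iso d e := by
  have hinj : Function.Injective ψ := by
    rw [injective_iff_map_eq_zero]
    intro u hu
    refine eq_zero_of_bil_eq_zero hd fun v => ?_
    rw [← hψ, hu, bil_zero_left]
  exact ⟨LinearEquiv.ofInjectiveOfFinrankEq ψ hinj (by simpa using hc), hψ⟩

/-- Isometries are stable under base change. -/
lemma Iso.map {K : Type u} [Field K] (f : F →+* K) {d : ι → F} {e : κ → F}
    (hd : ∀ i, d i ≠ 0) (h : Iso d e) : Iso (fun i => f (d i)) (fun i => f (e i)) := by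
  have hc := h.card_eq
  obtain ⟨φ, hφ⟩ := h
  let M : Matrix κ ι K := fun k i => f (φ (Pi.single i 1) k)
  refine Iso.of_linearMap (by simpa using hd) hc M.mulVecLin fun u v => ?_
  have key : ∀ i j, ∑ k, f (e k) * M k i * M k j = if i = j then f (d i) else 0 := by
    intro i j
    have h1 := congr_arg f (hφ (Pi.single i 1) (Pi.single j 1))
    rw [bil_single_right] at h1
    simp only [bil, map_sum, map_mul] at h1
    rw [h1]
    by_cases hij : i = j
    · simp [hij]
    · simp [hij, Ne.symm hij]
  calc bil (fun i => f (e i)) (M.mulVecLin u) (M.mulVecLin v)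
      = ∑ k, ∑ i, ∑ j, u i * v j * (f (e k) * M k i * M k j) := by
        simp only [bil, Matrix.mulVecLin_apply, Matrix.mulVec, dotProduct]
        refine Finset.sum_congr rfl fun k _ => ?_
        simp only [Finset.mul_sum, Finset.sum_mul]
        rw [Finset.sum_comm]
        exact Finset.sum_congr rfl fun i _ => Finset.sum_congr rfl fun j _ => by ring
    _ = ∑ i, ∑ j, u i * v j * ∑ k, f (e k) * M k i * M k j := by
        rw [Finset.sum_comm]
        refine Finset.sum_congr rfl fun i _ => ?_
        rw [Finset.sum_comm]
        exact Finset.sum_congr rfl fun j _ => by rw [Finset.mul_sum]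
    _ = bil (fun i => f (d i)) u v := by
        simp only [key, bil, mul_ite, mul_zero, Finset.sum_ite_eq, Finset.mem_univ, if_true]
        exact Finset.sum_congr rfl fun i _ => by ring

variable [NeZero (2 : F)]

lemma polar_preserved {d : ι → F} {e : κ → F} (φ : (ι → F) →ₗ[F] (κ → F))
    (h : ∀ v, bil e (φ v) (φ v) = bil d v v) (u v : ι → F) : bil e (φ u) (φ v) = bil d u v := by
  have h1 := h (u + v)
  simp only [map_add, bil_add_left, bil_add_right, h] at h1
  rw [bil_comm e (φ v), bil_comm d v u] at h1
  exact mul_left_cancel₀ (NeZero.ne (2 : F)) (by linear_combination h1)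

lemma exists_reflection (e : ι → F) (z : ι → F) (hz : bil e z z ≠ 0) :
    ∃ φ : (ι → F) ≃ₗ[F] (ι → F), (∀ u v, bil e (φ u) (φ v) = bil e u v) ∧
      ∀ u, φ u = u - (2 * bil e z u / bil e z z) • z := by
  let f : Module.Dual F (ι → F) :=
    { toFun := fun u => 2 * bil e z u / bil e z z
      map_add' := fun u v => by rw [bil_add_right]; ring
      map_smul' := fun c u => by rw [bil_smul_right]; simp; ring }
  have hf : f z = 2 := by
    change 2 * bil e z z / bil e z z = 2
    field_simp
  refine ⟨Module.reflection hf, fun u v => ?_, fun u => Module.reflection_apply u hf⟩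
  rw [Module.reflection_apply, Module.reflection_apply]
  change bil e (u - (2 * bil e z u / bil e z z) • z) (v - (2 * bil e z v / bil e z z) • z) = _
  simp only [bil_sub_left, bil_sub_right, bil_smul_left, bil_smul_right]
  rw [bil_comm e u z]
  field_simp
  ring

/-- The isometry group acts transitively on vectors of given nonzero length. -/
lemma exists_isometry_apply_eq (e : ι → F) (v w : ι → F) (hv : bil e v v ≠ 0)
    (hvw : bil e v v = bil e w w) :
    ∃ φ : (ι → F) ≃ₗ[F] (ι → F), (∀ x y, bil e (φ x) (φ y) = bil e x y) ∧ φ v = w := by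
  have h2 := NeZero.ne (2 : F)
  by_cases h : bil e (v - w) (v - w) = 0
  · have h' : bil e (v + w) (v + w) ≠ 0 := by
      intro h'
      apply mul_ne_zero (mul_ne_zero h2 h2) hv
      simp only [bil_sub_left, bil_sub_right, bil_add_left, bil_add_right] at h h'
      linear_combination h + h' + 2 * hvw
    obtain ⟨φ, hφ, hφ'⟩ := exists_reflection e _ h'
    refine ⟨φ.trans (LinearEquiv.neg F), fun x y => by simp [bil_neg_left, bil_neg_right, hφ], ?_⟩
    have h1 : 2 * bil e (v + w) v / bil e (v + w) (v + w) = 1 := by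
      rw [div_eq_one_iff_eq h']
      simp only [bil_add_left, bil_add_right]
      rw [bil_comm e w v]
      linear_combination hvw
    simp [hφ', h1]
  · obtain ⟨φ, hφ, hφ'⟩ := exists_reflection e _ h
    refine ⟨φ, hφ, ?_⟩
    have h1 : 2 * bil e (v - w) v / bil e (v - w) (v - w) = 1 := by
      rw [div_eq_one_iff_eq h]
      simp only [bil_sub_left, bil_sub_right]
      rw [bil_comm e w v]
      linear_combination hvw
    simp [hφ', h1]

/-- One-dimensional Witt cancellation. -/
lemma Iso.cancel_one {d : ι → F} {e : κ → F} (hd : ∀ i, d i ≠ 0) {a : F} (ha : a ≠ 0)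
    (h : Iso (Sum.elim d fun _ : Unit => a) (Sum.elim e fun _ : Unit => a)) : Iso d e := by
  have hc := h.card_eq
  obtain ⟨φ, hφ⟩ := h
  let x : ι ⊕ Unit → F := Sum.elim 0 1
  let y : κ ⊕ Unit → F := Sum.elim 0 1
  have hx : bil (Sum.elim d fun _ : Unit => a) x x = a := by
    rw [bil_sumElim]; simp [x, bil]
  have hy : bil (Sum.elim e fun _ : Unit => a) y y = a := by
    rw [bil_sumElim]; simp [y, bil]
  obtain ⟨ψ, hψ, hψx⟩ := exists_isometry_apply_eq (Sum.elim e fun _ : Unit => a) (φ x) y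
    (by rwa [hφ, hx]) (by rw [hφ, hx, hy])
  let inc : (ι → F) →ₗ[F] (ι ⊕ Unit → F) :=
    { toFun := fun u => Sum.elim u 0
      map_add' := fun u v => by ext (i | i) <;> simp
      map_smul' := fun c u => by ext (i | i) <;> simp }
  let res : (κ ⊕ Unit → F) →ₗ[F] (κ → F) := LinearMap.funLeft F F Sum.inl
  have hperp : ∀ u, ψ (φ (inc u)) (Sum.inr ()) = 0 := by
    intro u
    have h1 : bil (Sum.elim e fun _ : Unit => a) (ψ (φ (inc u))) (ψ (φ x)) = 0 := by
      rw [hψ, hφ, bil_sumElim]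
      simp [bil, inc, x]
    rw [hψx, bil_sumElim] at h1
    simpa [bil, y, ha] using h1
  refine Iso.of_linearMap hd (by simpa using hc)
    (res ∘ₗ ψ.toLinearMap ∘ₗ φ.toLinearMap ∘ₗ inc) fun u v => ?_
  have h1 : bil (Sum.elim e fun _ : Unit => a) (ψ (φ (inc u))) (ψ (φ (inc v))) = bil d u v := by
    rw [hψ, hφ, bil_sumElim]
    simp [bil, inc]
  rw [← h1, bil_sumElim]
  simp only [bil, Function.comp, Finset.univ_unique, Finset.sum_singleton]
  simp [hperp, res, LinearMap.funLeft]

end Geometry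

section WittRing

variable {F : Type u} [Field F]
variable {ι κ μ ν : Type} [Fintype ι] [Fintype κ] [Fintype μ] [Fintype ν]

/-- Isometry of diagonal forms given by units. -/
def IsoU (d : ι → Fˣ) (e : κ → Fˣ) : Prop := Iso (Units.val ∘ d) (Units.val ∘ e)

lemma IsoU.sum {d : ι → Fˣ} {e : κ → Fˣ} {d' : μ → Fˣ} {e' : ν → Fˣ} (h : IsoU d e)
    (h' : IsoU d' e') : IsoU (Sum.elim d d') (Sum.elim e e') := by
  unfold IsoU
  rw [Sum.comp_elim, Sum.comp_elim]
  exact Iso.sum h h'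

/-- The class of a diagonal form in the group ring of the unit group. -/
noncomputable def groupClass (d : ι → Fˣ) : MonoidAlgebra ℤ Fˣ := ∑ i, MonoidAlgebra.of ℤ Fˣ (d i)

lemma groupClass_sumElim (d : ι → Fˣ) (e : κ → Fˣ) :
    groupClass (Sum.elim d e) = groupClass d + groupClass e := by
  simp [groupClass, Fintype.sum_sum_type]

lemma groupClass_smul (a : Fˣ) (d : ι → Fˣ) :
    groupClass (fun i => a * d i) = MonoidAlgebra.of ℤ Fˣ a * groupClass d := by
  simp only [groupClass, Finset.mul_sum, map_mul]

lemma groupClass_coeff (d : ι → Fˣ) (a : Fˣ) :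
    (groupClass d).coeff a = Fintype.card {i // d i = a} := by
  simp [groupClass, MonoidAlgebra.coeff_sum, Finsupp.single_apply, Fintype.card_subtype]

/-- Forms with the same class in the group ring agree up to a permutation. -/
lemma IsoU.of_groupClass_eq {d : ι → Fˣ} {e : κ → Fˣ} (h : groupClass d = groupClass e) :
    IsoU d e := by
  have hc : ∀ a, Nonempty ({i // d i = a} ≃ {i // e i = a}) := fun a => by
    rw [← Fintype.card_eq]
    have := groupClass_coeff d a
    rw [h, groupClass_coeff] at this
    exact_mod_cast this.symm
  let σ : ι ≃ κ := Equiv.ofFiberEquiv fun a => (hc a).some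
  have hσ : d = e ∘ σ := funext fun i => (Equiv.ofFiberEquiv_map _ i).symm
  rw [hσ]
  exact Iso.reindex (Units.val ∘ e) σ

/-- `k` hyperbolic planes. -/
def hyp (k : ℕ) : Fin k ⊕ Fin k → Fˣ := Sum.elim (fun _ => 1) fun _ => -1

lemma groupClass_hyp (k : ℕ) :
    groupClass (hyp k : _ → Fˣ) = k * (1 + MonoidAlgebra.of ℤ Fˣ (-1)) := by
  rw [hyp, groupClass_sumElim]
  simp only [groupClass, Finset.sum_const, Finset.card_univ, Fintype.card_fin, nsmul_eq_mul,
    map_one]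
  ring

/-- The relations defining the Witt ring. -/
inductive IsWittRel (F : Type u) [Field F] : MonoidAlgebra ℤ Fˣ → Prop
  | iso {m n : ℕ} (d : Fin m → Fˣ) (e : Fin n → Fˣ) (h : IsoU d e) :
      IsWittRel F (groupClass d - groupClass e)
  | hyp : IsWittRel F (1 + MonoidAlgebra.of ℤ Fˣ (-1))

/-- The Witt ring as a quotient of the integral group ring of the unit group. -/
def W (F : Type u) [Field F] : Type u :=
  MonoidAlgebra ℤ Fˣ ⧸ Ideal.span {x | IsWittRel F x}

noncomputable instance W.instCommRing : CommRing (W F) :=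
  Ideal.Quotient.commRing (Ideal.span {x | IsWittRel F x})

/-- The projection from the group ring onto the Witt ring. -/
noncomputable def W.mk : MonoidAlgebra ℤ Fˣ →+* W F :=
  Ideal.Quotient.mk (Ideal.span {x | IsWittRel F x})

lemma W.mk_surjective : Function.Surjective (W.mk : MonoidAlgebra ℤ Fˣ →+* W F) :=
  Ideal.Quotient.mk_surjective

lemma W.mk_eq_mk {x y : MonoidAlgebra ℤ Fˣ} :
    W.mk x = W.mk y ↔ x - y ∈ Ideal.span {x | IsWittRel F x} :=
  Ideal.Quotient.eq

lemma W.mk_eq_zero {x : MonoidAlgebra ℤ Fˣ} (h : IsWittRel F x) : W.mk x = 0 :=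
  Ideal.Quotient.eq_zero_iff_mem.2 (Ideal.subset_span h)

/-- The universal property of the Witt ring. -/
noncomputable def W.lift {R : Type*} [CommRing R] (φ : MonoidAlgebra ℤ Fˣ →+* R)
    (h : ∀ x, IsWittRel F x → φ x = 0) : W F →+* R :=
  Ideal.Quotient.lift _ φ fun _ hx => (Ideal.span_le (I := RingHom.ker φ)).2 h hx

lemma W.lift_mk {R : Type*} [CommRing R] (φ : MonoidAlgebra ℤ Fˣ →+* R)
    (h : ∀ x, IsWittRel F x → φ x = 0) (x : MonoidAlgebra ℤ Fˣ) : W.lift φ h (W.mk x) = φ x :=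
  rfl

attribute [irreducible] W.instCommRing W

/-- The Witt class of the one-dimensional form with coefficient `a`, and `0` if `a = 0`. -/
noncomputable def br (a : F) : W F :=
  if h : a = 0 then 0 else W.mk (MonoidAlgebra.of ℤ Fˣ (Units.mk0 a h))

/-- The Witt class of a diagonal form. -/
noncomputable def cls (d : ι → F) : W F := ∑ i, br (d i)

lemma br_units (a : Fˣ) : br (a : F) = W.mk (MonoidAlgebra.of ℤ Fˣ a) := by
  simp [br]

lemma cls_units (d : ι → Fˣ) : cls (Units.val ∘ d) = W.mk (groupClass d) := by
  simp only [cls, groupClass, map_sum, Function.comp, br_units]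

@[simp] lemma br_zero : br (0 : F) = 0 := by simp [br]

@[simp] lemma br_one : br (1 : F) = 1 := by
  have := br_units (1 : Fˣ)
  rw [Units.val_one] at this
  rw [this, map_one, map_one]

lemma br_mul (a b : F) : br (a * b) = br a * br b := by
  by_cases ha : a = 0
  · simp [ha]
  by_cases hb : b = 0
  · simp [hb]
  lift a to Fˣ using isUnit_iff_ne_zero.2 ha
  lift b to Fˣ using isUnit_iff_ne_zero.2 hb
  rw [← Units.val_mul, br_units, br_units, br_units, map_mul, map_mul]

lemma br_neg_one : br (-1 : F) = -1 := by
  have h := br_units (-1 : Fˣ)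
  rw [Units.val_neg, Units.val_one] at h
  have h2 := W.mk_eq_zero (F := F) IsWittRel.hyp
  rw [map_add, map_one, ← h] at h2
  linear_combination h2

lemma br_neg (a : F) : br (-a) = -br a := by
  rw [neg_eq_neg_one_mul, br_mul, br_neg_one, neg_one_mul]

lemma cls_eq_of_iso {d : ι → F} {e : κ → F} (he : ∀ i, e i ≠ 0) (h : Iso d e) :
    cls d = cls e := by
  have hd := h.ne_zero he
  have key : ∀ {ι : Type} [Fintype ι] (d : ι → F) (hd : ∀ i, d i ≠ 0),
      cls d = W.mk
        (groupClass fun i => Units.mk0 (d ((Fintype.equivFin ι).symm i)) (hd _)) := by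
    intro ι _ d hd
    rw [← cls_units]
    exact (Equiv.sum_comp (Fintype.equivFin ι).symm fun i => br (d i)).symm
  rw [key d hd, key e he, W.mk_eq_mk]
  refine Ideal.subset_span (IsWittRel.iso _ _ ?_)
  exact ((Iso.reindex d _).trans h).trans (Iso.reindex e _).symm

lemma br_mul_sq (a : F) {b : F} (hb : b ≠ 0) : br (a * b ^ 2) = br a := by
  by_cases ha : a = 0
  · simp [ha]
  have h : cls (fun _ : Unit => a * b ^ 2) = cls (fun _ : Unit => a) := by
    refine cls_eq_of_iso (fun _ => ha) (Iso.of_linearMap (by simp [ha, hb]) rfl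
      (b • LinearMap.id) fun u v => ?_)
    simp [bil]
    ring
  simpa [cls] using h

lemma br_sq {b : F} (hb : b ≠ 0) : br b * br b = 1 := by
  rw [← br_mul, ← br_one, ← br_mul_sq 1 hb]
  ring_nf

lemma br_add_br (a b : F) : br a + br b = br (a + b) * (1 + br (a * b)) := by
  by_cases ha : a = 0
  · simp [ha]
  by_cases hb : b = 0
  · simp [hb]
  by_cases hab : a + b = 0
  · rw [hab, eq_neg_of_add_eq_zero_right hab, br_neg]
    simp
  have h : cls ![a + b, a * b * (a + b)] = cls ![a, b] := by
    refine cls_eq_of_iso (by simp [Fin.forall_fin_two, ha, hb])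
      (Iso.of_linearMap (by simp [Fin.forall_fin_two, ha, hb, hab]) rfl
        (Matrix.mulVecLin !![1, b; 1, -a]) fun u v => ?_)
    simp [bil, Matrix.mulVec, dotProduct, Fin.sum_univ_two]
    ring
  simp only [cls, Fin.sum_univ_two, Matrix.cons_val_zero, Matrix.cons_val_one, br_mul] at h
  rw [br_mul]
  linear_combination -h

lemma cls_cons {n : ℕ} (a : F) (d : Fin n → F) :
    cls (Fin.cons a d : Fin (n + 1) → F) = br a + cls d := by
  simp [cls, Fin.sum_univ_succ]

lemma cls_smul (a : F) (d : ι → F) : cls (fun i => a * d i) = br a * cls d := by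
  simp only [cls, Finset.mul_sum, br_mul]

lemma cls_sumElim (d : ι → F) (e : κ → F) : cls (Sum.elim d e) = cls d + cls e := by
  simp [cls, Fintype.sum_sum_type]

lemma cls_comp_equiv (e : κ → F) (σ : ι ≃ κ) : cls (e ∘ σ) = cls e :=
  Equiv.sum_comp σ fun i => br (e i)

/-- Every element of the Witt ring is the class of a form. -/
lemma exists_cls_eq (x : W F) : ∃ (n : ℕ) (d : Fin n → F), x = cls d := by
  obtain ⟨x, rfl⟩ := W.mk_surjective x
  suffices ∃ (ι : Type) (_ : Fintype ι) (d : ι → F), W.mk x = cls d by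
    obtain ⟨ι, _, d, hd⟩ := this
    exact ⟨_, d ∘ (Fintype.equivFin ι).symm, by rw [cls_comp_equiv, hd]⟩
  induction x using MonoidAlgebra.induction_on with
  | of a => exact ⟨Unit, inferInstance, fun _ => a, by simp [cls, br_units]⟩
  | add x y hx hy =>
    obtain ⟨ι, _, d, hd⟩ := hx
    obtain ⟨κ, _, e, he⟩ := hy
    exact ⟨ι ⊕ κ, inferInstance, Sum.elim d e, by rw [map_add, hd, he, cls_sumElim]⟩
  | smul r x hx =>
    obtain ⟨ι, _, d, hd⟩ := hx
    have hr : W.mk (r • x) = r * cls d := by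
      rw [zsmul_eq_mul, map_mul, hd, map_intCast]
    rw [hr]
    obtain ⟨n, rfl | rfl⟩ := r.eq_nat_or_neg
    · refine ⟨Fin n × ι, inferInstance, fun i => d i.2, ?_⟩
      simp [cls, Fintype.sum_prod_type]
    · refine ⟨Fin n × ι, inferInstance, fun i => -d i.2, ?_⟩
      simp [cls, Fintype.sum_prod_type, br_neg]

section BaseChange

variable {K : Type u} [Field K] (f : F →+* K)

/-- Base change of Witt rings. -/
noncomputable def bc : W F →+* W K :=
  W.lift ((W.mk (F := K)).comp (MonoidAlgebra.mapDomainRingHom ℤ (Units.map (f : F →* K)))) <| by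
    rintro x (⟨d, e, h⟩ | _)
    · have key : ∀ {n : ℕ} (d : Fin n → Fˣ),
          MonoidAlgebra.mapDomainRingHom ℤ (Units.map (f : F →* K)) (groupClass d) =
            groupClass fun i => Units.map (f : F →* K) (d i) := by
        intro n d
        simp [groupClass]
      rw [RingHom.comp_apply, map_sub, key, key]
      exact W.mk_eq_zero (IsWittRel.iso _ _ (Iso.map f (by simp) h))
    · have h : MonoidAlgebra.mapDomainRingHom ℤ (Units.map (f : F →* K))
          (1 + MonoidAlgebra.of ℤ Fˣ (-1)) = 1 + MonoidAlgebra.of ℤ Kˣ (-1) := by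
        rw [map_add, map_one]
        simp
      rw [RingHom.comp_apply, h]
      exact W.mk_eq_zero IsWittRel.hyp

lemma bc_mk (x : MonoidAlgebra ℤ Fˣ) :
    bc f (W.mk x) = W.mk (MonoidAlgebra.mapDomainRingHom ℤ (Units.map (f : F →* K)) x) :=
  W.lift_mk ..

lemma bc_br (a : F) : bc f (br a) = br (f a) := by
  by_cases ha : a = 0
  · simp [ha]
  lift a to Fˣ using isUnit_iff_ne_zero.2 ha
  have h := br_units (Units.map (f : F →* K) a)
  rw [Units.coe_map, MonoidHom.coe_coe] at h
  rw [h, br_units, bc_mk]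
  simp

lemma bc_cls (d : ι → F) : bc f (cls d) = cls fun i => f (d i) := by
  simp only [cls, map_sum, bc_br]

lemma bc_comp {L : Type u} [Field L] (g : K →+* L) (x : W F) :
    bc g (bc f x) = bc (g.comp f) x := by
  obtain ⟨n, d, rfl⟩ := exists_cls_eq x
  simp only [bc_cls, RingHom.comp_apply]

end BaseChange

section Soundness

/-- Isometry up to hyperbolic planes. -/
def WEq (d : ι → Fˣ) (e : κ → Fˣ) : Prop :=
  ∃ k l : ℕ, IsoU (Sum.elim d (hyp k)) (Sum.elim e (hyp l))

lemma WEq.symm {d : ι → Fˣ} {e : κ → Fˣ} (h : WEq d e) : WEq e d := by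
  obtain ⟨k, l, h⟩ := h
  exact ⟨l, k, h.symm⟩

lemma WEq.of_groupClass_eq {d : ι → Fˣ} {e : κ → Fˣ} (h : groupClass d = groupClass e) :
    WEq d e :=
  ⟨0, 0, .of_groupClass_eq (by simp only [groupClass_sumElim, h])⟩

lemma WEq.sum {d : ι → Fˣ} {e : κ → Fˣ} {d' : μ → Fˣ} {e' : ν → Fˣ} (h : WEq d e)
    (h' : WEq d' e') : WEq (Sum.elim d d') (Sum.elim e e') := by
  obtain ⟨k, l, h⟩ := h
  obtain ⟨k', l', h'⟩ := h'
  refine ⟨k + k', l + l', ?_⟩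
  have key : ∀ {ι μ : Type} [Fintype ι] [Fintype μ] (d : ι → Fˣ) (d' : μ → Fˣ) (k k' : ℕ),
      IsoU (Sum.elim (Sum.elim d d') (hyp (k + k')))
        (Sum.elim (Sum.elim d (hyp k)) (Sum.elim d' (hyp k'))) := by
    intro ι μ _ _ d d' k k'
    refine .of_groupClass_eq ?_
    simp only [groupClass_sumElim, groupClass_hyp]
    push_cast
    ring
  exact ((key ..).trans (h.sum h')).trans (key ..).symm

variable [NeZero (2 : F)]

lemma isoU_smul_hyp (a : Fˣ) (k : ℕ) : IsoU (fun i => a * hyp k i) (hyp k : _ → Fˣ) := by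
  have h2 := NeZero.ne (2 : F)
  let p : Matrix (Fin k ⊕ Fin k) (Fin k ⊕ Fin k) F :=
    Matrix.fromBlocks (Matrix.scalar _ ((1 + a) / 2)) (Matrix.scalar _ ((1 - a) / 2))
      (Matrix.scalar _ ((1 - a) / 2)) (Matrix.scalar _ ((1 + a) / 2))
  refine Iso.of_linearMap (by simp) rfl p.mulVecLin fun u v => ?_
  simp only [bil, Fintype.sum_sum_type, hyp, Matrix.mulVecLin_apply, p, Matrix.fromBlocks_mulVec]
  rw [← Finset.sum_add_distrib, ← Finset.sum_add_distrib]
  refine Finset.sum_congr rfl fun i _ => ?_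
  simp
  field_simp
  ring

/-- Witt cancellation. -/
lemma IsoU.cancel {d : ι → Fˣ} {e : κ → Fˣ} (f : μ → Fˣ)
    (h : IsoU (Sum.elim d f) (Sum.elim e f)) : IsoU d e := by
  suffices H : ∀ (n : ℕ) (f : Fin n → Fˣ), IsoU (Sum.elim d f) (Sum.elim e f) → IsoU d e by
    let σ := (Fintype.equivFin μ).symm
    have hσ : groupClass (f ∘ σ) = groupClass f :=
      Equiv.sum_comp σ fun i => MonoidAlgebra.of ℤ Fˣ (f i)
    have h1 : IsoU (Sum.elim d (f ∘ σ)) (Sum.elim d f) :=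
      .of_groupClass_eq (by simp only [groupClass_sumElim, hσ])
    have h2 : IsoU (Sum.elim e f) (Sum.elim e (f ∘ σ)) :=
      .of_groupClass_eq (by simp only [groupClass_sumElim, hσ])
    exact H _ (f ∘ σ) ((h1.trans h).trans h2)
  intro n
  induction n with
  | zero =>
    intro f h
    have h1 : IsoU d (Sum.elim d f) := .of_groupClass_eq (by
      simp [groupClass])
    have h2 : IsoU (Sum.elim e f) e := .of_groupClass_eq (by
      simp [groupClass])
    exact (h1.trans h).trans h2
  | succ n ih =>
    intro f h
    refine ih (Fin.tail f) ?_
    have h1 : ∀ {ι : Type} [Fintype ι] (d : ι → Fˣ),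
        IsoU (Sum.elim (Sum.elim d (Fin.tail f)) fun _ : Unit => f 0) (Sum.elim d f) := by
      intro ι _ d
      refine .of_groupClass_eq ?_
      simp only [groupClass_sumElim]
      simp [groupClass, Fin.sum_univ_succ, Fin.tail]
      ring
    have h2 : IsoU (Sum.elim (Sum.elim d (Fin.tail f)) fun _ : Unit => f 0)
        (Sum.elim (Sum.elim e (Fin.tail f)) fun _ : Unit => f 0) :=
      ((h1 d).trans h).trans (h1 e).symm
    unfold IsoU at h2 ⊢
    rw [Sum.comp_elim Units.val (Sum.elim d _), Sum.comp_elim Units.val (Sum.elim e _)] at h2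
    exact Iso.cancel_one (by simp) (Units.ne_zero (f 0)) h2

lemma WEq.smul {d : ι → Fˣ} {e : κ → Fˣ} (a : Fˣ) (h : WEq d e) :
    WEq (fun i => a * d i) (fun i => a * e i) := by
  obtain ⟨k, l, h⟩ := h
  refine ⟨k, l, ?_⟩
  have key : ∀ {ι : Type} [Fintype ι] (d : ι → Fˣ) (k : ℕ),
      IsoU (fun i => a * Sum.elim d (hyp k) i) (Sum.elim (fun i => a * d i) (hyp k)) := by
    intro ι _ d k
    have h1 : IsoU (fun i => a * Sum.elim d (hyp k) i)
        (Sum.elim (fun i => a * d i) (fun i => a * hyp k i)) :=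
      .of_groupClass_eq (by
        simp only [groupClass_smul, groupClass_sumElim]
        ring)
    exact h1.trans (IsoU.sum (Iso.refl _) (isoU_smul_hyp a k))
  exact ((key d k).symm.trans (Iso.scale h (a : F))).trans (key e l)

lemma WEq.trans_sub {d : ι → Fˣ} {e : κ → Fˣ} {d' : μ → Fˣ} {e' : ν → Fˣ}
    (h : groupClass d - groupClass e = groupClass d' - groupClass e') (h' : WEq d' e') :
    WEq d e := by
  obtain ⟨k, l, h'⟩ := h'
  refine ⟨k, l, IsoU.cancel e' ?_⟩
  have h1 : IsoU (Sum.elim (Sum.elim d (hyp k)) e') (Sum.elim e (Sum.elim d' (hyp k))) := by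
    refine .of_groupClass_eq ?_
    simp only [groupClass_sumElim]
    linear_combination h
  have h2 : IsoU (Sum.elim e (Sum.elim e' (hyp l))) (Sum.elim (Sum.elim e (hyp l)) e') := by
    refine .of_groupClass_eq ?_
    simp only [groupClass_sumElim]
    ring
  exact (h1.trans (IsoU.sum (Iso.refl _) h')).trans h2

/-- The elements of the ideal defining the Witt ring. -/
lemma exists_wEq_of_mem {x : MonoidAlgebra ℤ Fˣ} (hx : x ∈ Ideal.span {x | IsWittRel F x}) :
    ∃ (ι κ : Type) (_ : Fintype ι) (_ : Fintype κ) (d : ι → Fˣ) (e : κ → Fˣ),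
      x = groupClass d - groupClass e ∧ WEq d e := by
  have hzero : ∃ (ι κ : Type) (_ : Fintype ι) (_ : Fintype κ) (d : ι → Fˣ) (e : κ → Fˣ),
      (0 : MonoidAlgebra ℤ Fˣ) = groupClass d - groupClass e ∧ WEq d e :=
    ⟨Empty, Empty, inferInstance, inferInstance, Empty.elim, Empty.elim, by simp,
      .of_groupClass_eq rfl⟩
  induction hx using Submodule.span_induction with
  | mem x hx =>
    obtain ⟨d, e, h⟩ | _ := hx
    · exact ⟨_, _, inferInstance, inferInstance, d, e, rfl, 0, 0, h.sum (Iso.refl _)⟩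
    · refine ⟨_, Empty, inferInstance, inferInstance, hyp 1, Empty.elim, ?_, 0, 1,
        .of_groupClass_eq ?_⟩
      · simp [groupClass_hyp]
        simp [groupClass]
      · simp [groupClass]
  | zero => exact hzero
  | add x y _ _ hx hy =>
    obtain ⟨ι, κ, _, _, d, e, rfl, h⟩ := hx
    obtain ⟨ι', κ', _, _, d', e', rfl, h'⟩ := hy
    exact ⟨_, _, inferInstance, inferInstance, _, _, by
      rw [groupClass_sumElim, groupClass_sumElim]; ring, h.sum h'⟩
  | smul c x _ hx =>
    rw [smul_eq_mul]
    induction c using MonoidAlgebra.induction_on with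
    | of a =>
      obtain ⟨ι, κ, _, _, d, e, rfl, h⟩ := hx
      exact ⟨_, _, inferInstance, inferInstance, _, _, by
        rw [groupClass_smul, groupClass_smul, mul_sub], h.smul a⟩
    | add b c hb hc =>
      obtain ⟨ι, κ, _, _, d, e, hd, h⟩ := hb
      obtain ⟨ι', κ', _, _, d', e', hd', h'⟩ := hc
      exact ⟨_, _, inferInstance, inferInstance, _, _, by
        rw [groupClass_sumElim, groupClass_sumElim, add_mul, hd, hd']; ring, h.sum h'⟩
    | smul r c hc =>
      rw [smul_mul_assoc]
      obtain ⟨ι, κ, _, _, d, e, hd, h⟩ := hc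
      rw [hd]
      induction r with
      | zero => simpa using hzero
      | succ n ih =>
        obtain ⟨ι', κ', _, _, d', e', hd', h'⟩ := ih
        exact ⟨_, _, inferInstance, inferInstance, _, _, by
          rw [groupClass_sumElim, groupClass_sumElim, add_smul, hd', one_smul]; ring, h'.sum h⟩
      | pred n ih =>
        obtain ⟨ι', κ', _, _, d', e', hd', h'⟩ := ih
        exact ⟨_, _, inferInstance, inferInstance, _, _, by
          rw [groupClass_sumElim, groupClass_sumElim, sub_smul, hd', one_smul]; ring, h'.sum h.symm⟩

lemma wEq_of_cls_eq {d : ι → Fˣ} {e : κ → Fˣ}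
    (h : cls (Units.val ∘ d) = cls (Units.val ∘ e)) : WEq d e := by
  rw [cls_units, cls_units, W.mk_eq_mk] at h
  obtain ⟨ι', κ', _, _, d', e', h1, h2⟩ := exists_wEq_of_mem h
  exact h2.trans_sub h1

/-- Forms of the same dimension with the same Witt class are isometric. -/
lemma iso_of_cls_eq {d : ι → F} {e : κ → F} (hd : ∀ i, d i ≠ 0) (he : ∀ i, e i ≠ 0)
    (hc : Fintype.card ι = Fintype.card κ) (h : cls d = cls e) : Iso d e := by
  lift d to ι → Fˣ using fun i => isUnit_iff_ne_zero.2 (hd i)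
  lift e to κ → Fˣ using fun i => isUnit_iff_ne_zero.2 (he i)
  obtain ⟨k, l, h⟩ := wEq_of_cls_eq (d := d) (e := e) h
  have h1 := h.card_eq
  simp only [Fintype.card_sum, Fintype.card_fin] at h1
  obtain rfl : k = l := by omega
  exact IsoU.cancel _ h

/-- A form with the Witt class of a form of smaller dimension is isotropic. -/
lemma isotropic_of_cls_eq {d : ι → F} {e : κ → F} (hd : ∀ i, d i ≠ 0)
    (hc : Fintype.card κ < Fintype.card ι) (h : cls d = cls e) :
    ∃ v, v ≠ 0 ∧ bil d v v = 0 := by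
  wlog he : ∀ i, e i ≠ 0 generalizing κ
  · refine this (e := fun i : {i // e i ≠ 0} => e i)
      ((Fintype.card_subtype_le _).trans_lt hc) ?_ fun i => i.2
    rw [h, cls, cls, ← Finset.sum_subtype (Finset.univ.filter fun i => e i ≠ 0) (by simp)
      fun i => br (e i)]
    refine (Finset.sum_filter_of_ne (p := fun i => e i ≠ 0) fun i _ hi h0 => hi ?_).symm
    rw [h0, br_zero]
  lift d to ι → Fˣ using fun i => isUnit_iff_ne_zero.2 (hd i)
  lift e to κ → Fˣ using fun i => isUnit_iff_ne_zero.2 (he i)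
  obtain ⟨k, l, h⟩ := wEq_of_cls_eq (d := d) (e := e) h
  have h1 := h.card_eq
  simp only [Fintype.card_sum, Fintype.card_fin] at h1
  obtain ⟨j, rfl⟩ : ∃ j, l = k + (j + 1) := ⟨l - k - 1, by omega⟩
  have h2 : IsoU (Sum.elim e (hyp (k + (j + 1))))
      (Sum.elim (Sum.elim e (hyp (j + 1))) (hyp k)) := by
    refine .of_groupClass_eq ?_
    simp only [groupClass_sumElim, groupClass_hyp]
    push_cast
    ring
  obtain ⟨φ, hφ⟩ := (IsoU.cancel _ (h.trans h2)).symm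
  let v : κ ⊕ (Fin (j + 1) ⊕ Fin (j + 1)) → F :=
    Sum.elim 0 (Sum.elim (Pi.single 0 1) (Pi.single 0 1))
  refine ⟨φ v, ?_, ?_⟩
  · rw [Ne, map_eq_zero_iff _ φ.injective]
    intro hv
    simpa [v] using congr_fun hv (Sum.inr (Sum.inl 0))
  · change bil (Units.val ∘ d) _ _ = 0
    rw [hφ]
    simp [bil, v, hyp, Fintype.sum_sum_type, Pi.single_apply]

end Soundness

end WittRing

section Length

variable {F : Type u} [Field F]

/-- Anisotropy of a diagonal form. -/
def Aniso {ι : Type} [Fintype ι] (d : ι → F) : Prop := ∀ v, bil d v v = 0 → v = 0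

/-- The Witt class `x` is represented by a diagonal form with at most `n` nonzero entries. -/
def Len (x : W F) (n : ℕ) : Prop := ∃ e : Fin n → F, x = cls e

lemma cls_succ {n : ℕ} (d : Fin (n + 1) → F) : cls d = br (d 0) + cls (Fin.tail d) := by
  simp [cls, Fin.sum_univ_succ, Fin.tail]

lemma cls_append {m n : ℕ} (d : Fin m → F) (e : Fin n → F) :
    cls (Fin.append d e) = cls d + cls e := by
  simp [cls, Fin.sum_univ_add]

lemma Len.add {x y : W F} {m n : ℕ} (hx : Len x m) (hy : Len y n) : Len (x + y) (m + n) := by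
  obtain ⟨d, rfl⟩ := hx
  obtain ⟨e, rfl⟩ := hy
  exact ⟨Fin.append d e, (cls_append d e).symm⟩

lemma Len.br_mul {x : W F} {n : ℕ} (hx : Len x n) (c : F) : Len (br c * x) n := by
  obtain ⟨d, rfl⟩ := hx
  exact ⟨fun i => c * d i, (cls_smul c d).symm⟩

lemma Len.bc {K : Type u} [Field K] (f : F →+* K) {x : W F} {n : ℕ} (hx : Len x n) :
    Len (bc f x) n := by
  obtain ⟨d, rfl⟩ := hx
  exact ⟨_, bc_cls f d⟩

lemma len_zero_iff {x : W F} : Len x 0 ↔ x = 0 := by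
  refine ⟨?_, fun h => ⟨Fin.elim0, by simp [h, cls]⟩⟩
  rintro ⟨d, rfl⟩
  simp [cls]

/-- A represented value can be split off. -/
lemma cls_eq_br_add {n : ℕ} (d : Fin (n + 1) → F) {v : Fin (n + 1) → F} (hv : v ≠ 0) :
    ∃ d' : Fin n → F, cls d = br (bil d v v) + cls d' := by
  induction n with
  | zero =>
    have h0 : v 0 ≠ 0 := fun h => hv (funext fun i => by rw [Fin.fin_one_eq_zero i, h]; rfl)
    refine ⟨Fin.elim0, ?_⟩
    have h1 : bil d v v = d 0 * v 0 ^ 2 := by simp [bil]; ring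
    rw [h1, br_mul_sq _ h0]
    simp [cls]
  | succ n ih =>
    have hb : bil d v v = d 0 * v 0 ^ 2 + bil (Fin.tail d) (Fin.tail v) (Fin.tail v) := by
      rw [bil_succ]; ring
    by_cases ht : Fin.tail v = 0
    · have h0 : v 0 ≠ 0 := fun h => hv (funext fun i => by
        refine Fin.cases h (fun j => congr_fun ht j) i)
      refine ⟨Fin.tail d, ?_⟩
      rw [hb, ht, bil_zero_left, add_zero, br_mul_sq _ h0, cls_succ]
    · obtain ⟨d', hd'⟩ := ih (Fin.tail d) ht
      rw [cls_succ, hd', hb]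
      set q := bil (Fin.tail d) (Fin.tail v) (Fin.tail v)
      by_cases h0 : v 0 = 0
      · refine ⟨Fin.cons (d 0) d', ?_⟩
        rw [cls_cons, h0, zero_pow two_ne_zero, mul_zero, zero_add]
        ring
      · refine ⟨Fin.cons ((d 0 * v 0 ^ 2 + q) * (d 0 * v 0 ^ 2 * q)) d', ?_⟩
        have h1 := br_add_br (d 0 * v 0 ^ 2) q
        rw [br_mul_sq _ h0] at h1
        rw [cls_cons, ArasonPfister.br_mul (d 0 * v 0 ^ 2 + q)]
        linear_combination h1

lemma Aniso.ne_zero {ι : Type} [Fintype ι] {d : ι → F} (hd : Aniso d) (i : ι) : d i ≠ 0 := by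
  intro h
  have := hd (Pi.single i 1) (by rw [bil_single_right, h, zero_mul])
  simpa using congr_fun this i

lemma Aniso.tail {n : ℕ} {d : Fin (n + 1) → F} (hd : Aniso d) : Aniso (Fin.tail d) := by
  intro v hv
  have := hd (Fin.cons 0 v) (by simp [bil_succ, hv])
  exact (Fin.cons_injective2 (this.trans (Fin.cons_self_tail 0).symm)).2

lemma aniso_of_le_len {n : ℕ} {d : Fin n → F} (h : ∀ m, Len (cls d) m → n ≤ m) : Aniso d := by
  intro v hv
  by_contra hv0
  cases n with
  | zero => exact hv0 (Subsingleton.elim _ _)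
  | succ n =>
    obtain ⟨d', hd'⟩ := cls_eq_br_add d hv0
    rw [hv, br_zero, zero_add] at hd'
    exact absurd (h n ⟨d', hd'⟩) (by omega)

/-- Every Witt class has an anisotropic representative. -/
lemma exists_aniso (x : W F) : ∃ (n : ℕ) (d : Fin n → F), Aniso d ∧ x = cls d := by
  have h : ∃ n, Len x n := exists_cls_eq x
  obtain ⟨d, hd⟩ := Nat.find_spec h
  exact ⟨_, d, aniso_of_le_len fun m hm => Nat.find_min' h (hd ▸ hm), hd⟩

variable [NeZero (2 : F)]

lemma Aniso.le_of_len {n m : ℕ} {d : Fin n → F} (hd : Aniso d) (h : Len (cls d) m) : n ≤ m := by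
  by_contra! hlt
  obtain ⟨e, he⟩ := h
  obtain ⟨v, hv, hv0⟩ := isotropic_of_cls_eq hd.ne_zero (by simpa using hlt) he
  exact hv (hd v hv0)

lemma Aniso.of_cls_eq {m n : ℕ} {d : Fin n → F} {e : Fin m → F} (hd : Aniso d) (hc : m ≤ n)
    (h : cls d = cls e) : Aniso e :=
  aniso_of_le_len fun _ hk => hc.trans (hd.le_of_len (h ▸ hk))

lemma Aniso.of_cls_eq_add {n k : ℕ} {d : Fin n → F} {d' : Fin k → F} (hd : Aniso d) {c : F}
    (hk : k + 1 ≤ n) (h : cls d = br c + cls d') : Aniso d' := by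
  have h1 : Aniso (Fin.cons c d' : Fin (k + 1) → F) := hd.of_cls_eq hk (by rw [h, cls_cons])
  simpa using h1.tail

/-- An anisotropic form represents `c` if splitting off `c` from its class lowers the length. -/
lemma Aniso.exists_bil_eq {n m : ℕ} {d : Fin n → F} (hd : Aniso d) {c : F} (hc : c ≠ 0)
    (h : Len (cls d - br c) m) (hm : m ≤ n) : ∃ v, bil d v v = c := by
  obtain ⟨e, he⟩ := h
  have h1 : cls (Fin.cons (-c) d : Fin (n + 1) → F) = cls e := by
    rw [cls_cons, br_neg, ← he]; ring
  obtain ⟨v, hv, hv0⟩ := isotropic_of_cls_eq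
    (Fin.cases (by simpa using hc) (by simpa using hd.ne_zero)) (by simpa [Nat.lt_succ_iff]) h1
  rw [bil_cons] at hv0
  have h0 : v 0 ≠ 0 := by
    intro h0
    rw [h0, mul_zero, zero_add] at hv0
    exact hv (funext fun i => Fin.cases h0 (fun j => congr_fun (hd _ hv0) j) i)
  refine ⟨(v 0)⁻¹ • Fin.tail v, ?_⟩
  rw [bil_smul_left, bil_smul_right]
  field_simp
  linear_combination hv0

/-- The orthogonal complement of a vector of length `c` in a form with class `br c + cls d'`
has the values of `d'`. -/
lemma exists_bil_eq_of_orthogonal {n : ℕ} {d : Fin (n + 1) → F} {d' : Fin n → F} {c : F}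
    (hd : ∀ i, d i ≠ 0) (hd' : ∀ i, d' i ≠ 0) (hc : c ≠ 0) (h : cls d = br c + cls d')
    {u w : Fin (n + 1) → F} (hw : bil d w w = c) (hu : bil d u w = 0) :
    ∃ u', bil d' u' u' = bil d u u := by
  obtain ⟨φ, hφ⟩ := iso_of_cls_eq hd (e := (Fin.cons c d' : Fin (n + 1) → F))
    (Fin.cases (by simpa using hc) (by simpa using hd')) rfl (by rw [h, cls_cons])
  obtain ⟨ψ, hψ, hψw⟩ := exists_isometry_apply_eq (Fin.cons c d' : Fin (n + 1) → F) (φ w)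
    (Pi.single 0 1) (by rwa [hφ, hw]) (by rw [hφ, hw, bil_single_right]; simp)
  have h0 : ψ (φ u) 0 = 0 := by
    have h1 := hφ u w
    rw [← hψ, hψw, hu, bil_single_right] at h1
    simpa [hc] using h1
  refine ⟨Fin.tail (ψ (φ u)), ?_⟩
  rw [← hφ, ← hψ, bil_cons, h0]
  ring

end Length

section Polynomials

open Polynomial

variable {K : Type u} [Field K] {n : ℕ} {d : Fin n → K}

/-- The value of an anisotropic form at a vector of polynomials of degree `N` has degree `2 * N`. -/
lemma Aniso.natDegree_bil (hd : Aniso d) {v : Fin n → K[X]} (hv : v ≠ 0) :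
    ∃ N, (∀ i, (v i).natDegree ≤ N) ∧ (∃ i, v i ≠ 0 ∧ N ≤ (v i).natDegree) ∧
      bil (fun i => C (d i)) v v ≠ 0 ∧ (bil (fun i => C (d i)) v v).natDegree = 2 * N := by
  obtain ⟨j, hj⟩ := Function.ne_iff.1 hv
  obtain ⟨i, hi, hmax⟩ := Finset.exists_max_image (Finset.univ.filter fun i => v i ≠ 0)
    (fun i => (v i).natDegree) ⟨j, by simpa using hj⟩
  have hi0 : v i ≠ 0 := by simpa using hi
  have hN : ∀ k, (v k).natDegree ≤ (v i).natDegree := by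
    intro k
    by_cases hk : v k = 0
    · simp [hk]
    · exact hmax k (by simpa using hk)
  have hcoeff : (bil (fun i => C (d i)) v v).coeff (2 * (v i).natDegree) ≠ 0 := by
    have h1 : (bil (fun i => C (d i)) v v).coeff (2 * (v i).natDegree) =
        bil d (fun k => (v k).coeff (v i).natDegree) fun k => (v k).coeff (v i).natDegree := by
      simp only [bil, finsetSum_coeff, mul_assoc, coeff_C_mul]
      refine Finset.sum_congr rfl fun k _ => ?_
      rw [two_mul, coeff_mul_add_eq_of_natDegree_le (hN k) (hN k)]
    rw [h1]
    intro h2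
    have h3 := congr_fun (hd _ h2) i
    simp [hi0] at h3
  refine ⟨(v i).natDegree, hN, ⟨i, hi0, le_rfl⟩, fun h => by simp [h] at hcoeff,
    le_antisymm (natDegree_sum_le_of_forall_le _ _ fun k _ => ?_) (le_natDegree_of_ne_zero hcoeff)⟩
  rw [mul_assoc]
  refine (natDegree_C_mul_le _ _).trans (natDegree_mul_le.trans ?_)
  have := hN k
  omega

/-- The Cassels–Pfister theorem. -/
lemma Aniso.cassels_pfister (hd : Aniso d) {f g : K[X]} (hg : g ≠ 0) {v : Fin n → K[X]}
    (h : bil (fun i => C (d i)) v v = f * g ^ 2) :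
    ∃ v : Fin n → K[X], bil (fun i => C (d i)) v v = f := by
  induction hN : g.natDegree using Nat.strong_induction_on generalizing g v with
  | _ N ih =>
    subst hN
    set B := bil (fun i => C (d i)) with hB
    let u : Fin n → K[X] := fun i => v i / g
    let r : Fin n → K[X] := fun i => v i % g
    have hvur : v = g • u + r := funext fun i => (EuclideanDomain.div_add_mod (v i) g).symm
    have hQv : B v v = g ^ 2 * B u u + 2 * g * B u r + B r r := by
      rw [hvur, hB]
      simp only [bil_add_left, bil_add_right, bil_smul_left, bil_smul_right]
      rw [bil_comm _ r u]
      ring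
    have hBvu : B v u = g * B u u + B u r := by
      rw [hvur, hB]
      simp only [bil_add_left, bil_smul_left]
      rw [bil_comm _ r u]
    by_cases hr : r = 0
    · refine ⟨u, ?_⟩
      rw [hr, hB, bil_comm _ u 0, bil_zero_left, bil_zero_left, ← hB, h] at hQv
      exact mul_right_cancel₀ (pow_ne_zero 2 hg) (by linear_combination -hQv)
    · obtain ⟨M, -, ⟨i, hi0, hi⟩, hne, hdeg⟩ := hd.natDegree_bil hr
      have hM : M < g.natDegree := hi.trans_lt
        (natDegree_lt_natDegree hi0 (EuclideanDomain.mod_lt (v i) hg))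
      let α := B u u - f
      let β := 2 * (f * g - B v u)
      have hgg : B r r = g * (α * g + β) := by
        simp only [α, β]
        linear_combination h - hQv + 2 * g * hBvu
      have hg' : α * g + β ≠ 0 := fun h0 => hne (by rw [← hB, hgg, h0, mul_zero])
      refine ih _ ?_ hg' (v := α • v + β • u) ?_ rfl
      · rw [← hB, hgg, natDegree_mul hg hg'] at hdeg
        omega
      · simp only [hB, bil_add_left, bil_add_right, bil_smul_left, bil_smul_right]
        rw [bil_comm _ u v, ← hB, h]
        simp only [α, β]
        ring

/-- The embedding of a field into its field of rational functions. -/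
noncomputable def toRat (K : Type u) [Field K] : K →+* FractionRing K[X] :=
  (algebraMap K[X] (FractionRing K[X])).comp C

lemma exists_clear_denom (v : Fin n → FractionRing K[X]) :
    ∃ (g : K[X]) (u : Fin n → K[X]), g ≠ 0 ∧
      ∀ i, algebraMap K[X] (FractionRing K[X]) (u i) = algebraMap _ _ g * v i := by
  obtain ⟨b, hb⟩ := IsLocalization.exist_integer_multiples_of_finite (nonZeroDivisors K[X]) v
  choose u hu using hb
  exact ⟨b, u, nonZeroDivisors.ne_zero b.2, fun i => by rw [hu, Algebra.smul_def]⟩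

lemma bil_toRat (v : Fin n → FractionRing K[X]) :
    ∃ (g : K[X]) (u : Fin n → K[X]), g ≠ 0 ∧ (u = 0 → v = 0) ∧
      algebraMap K[X] (FractionRing K[X]) (bil (fun i => C (d i)) u u) =
        algebraMap _ _ (g ^ 2) * bil (fun i => toRat K (d i)) v v := by
  obtain ⟨g, u, hg, hu⟩ := exists_clear_denom v
  have hg' : algebraMap K[X] (FractionRing K[X]) g ≠ 0 := by simpa using hg
  refine ⟨g, u, hg, fun h => funext fun i => ?_, ?_⟩
  · have := hu i
    simpa [h, hg] using this.symm
  · rw [map_bil]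
    have hu' : (fun i => algebraMap K[X] (FractionRing K[X]) (u i)) =
      algebraMap K[X] (FractionRing K[X]) g • v := funext hu
    rw [hu', bil_smul_left, bil_smul_right, map_pow, pow_two, mul_assoc]
    rfl

lemma Aniso.toRat (hd : Aniso d) : Aniso fun i => toRat K (d i) := by
  intro v hv
  obtain ⟨g, u, -, hu, h⟩ := bil_toRat (d := d) v
  by_contra hv0
  obtain ⟨-, -, -, hne, -⟩ := hd.natDegree_bil (mt hu hv0)
  rw [hv, mul_zero] at h
  exact hne (by simpa using h)

/-- If an anisotropic form represents `a + p * X ^ 2` over `K(X)`, then it represents `a` and `p`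
over `K` by orthogonal vectors. -/
lemma Aniso.exists_orthogonal [NeZero (2 : K)] (hd : Aniso d) {a p : K}
    {v : Fin n → FractionRing K[X]}
    (hv : bil (fun i => ArasonPfister.toRat K (d i)) v v =
      ArasonPfister.toRat K a + ArasonPfister.toRat K p * algebraMap K[X] _ X ^ 2) :
    ∃ u w, bil d u u = a ∧ bil d u w = 0 ∧ bil d w w = p := by
  obtain ⟨g, u, hg, -, h⟩ := bil_toRat (d := d) v
  have h1 : bil (fun i => C (d i)) u u = (C a + C p * X ^ 2) * g ^ 2 := by
    refine IsFractionRing.injective K[X] (FractionRing K[X]) ?_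
    rw [h, hv]
    simp only [ArasonPfister.toRat, RingHom.comp_apply, map_mul, map_add, map_pow]
    ring
  obtain ⟨w, hw⟩ := hd.cassels_pfister hg h1
  have hdeg : ∀ i, (w i).natDegree ≤ 1 := by
    intro i
    by_cases hw0 : w = 0
    · simp [hw0]
    obtain ⟨N, hN, -, -, hN'⟩ := hd.natDegree_bil hw0
    rw [hw] at hN'
    have h2 : (C a + C p * X ^ 2 : K[X]).natDegree ≤ 2 := by compute_degree
    have := hN i
    omega
  let x : Fin n → K := fun i => (w i).coeff 0
  let y : Fin n → K := fun i => (w i).coeff 1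
  have hwxy : w = (fun i => C (x i)) + (X : K[X]) • fun i => C (y i) := by
    ext1 i
    have := eq_X_add_C_of_natDegree_le_one (hdeg i)
    rw [this]
    simp [x, y]
    ring
  rw [hwxy] at hw
  simp only [bil_add_left, bil_add_right, bil_smul_left, bil_smul_right] at hw
  rw [bil_comm _ (fun i => C (y i)) fun i => C (x i), ← map_bil, ← map_bil, ← map_bil] at hw
  have hw' : C (bil d x x) + C (2 * bil d x y) * X + C (bil d y y) * X ^ 2 =
      C a + C p * X ^ 2 := by
    rw [← hw, two_mul, map_add]
    ring
  have h0 := congr_arg (coeff · 0) hw'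
  have h1 := congr_arg (coeff · 1) hw'
  have h2 := congr_arg (coeff · 2) hw'
  simp [coeff_X, coeff_C, coeff_X_pow, NeZero.ne (2 : K)] at h0 h1 h2
  exact ⟨x, y, h0, h1, h2⟩

end Polynomials

section Generic

lemma neZero_two_of_ringHom {F : Type*} [Field F] [NeZero (2 : F)] {K : Type*} [Field K]
    (f : F →+* K) : NeZero (2 : K) :=
  ⟨fun h => NeZero.ne (2 : F) (f.injective (by rw [map_ofNat, map_zero, h]))⟩

/-- A vector `x` over a purely transcendental extension whose coordinates are independent
variables: the subform theorem of Cassels and Pfister holds for values at `x`. -/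
lemma exists_generic (F : Type u) [Field F] [NeZero (2 : F)] (m : ℕ) :
    ∃ (K : Type u) (_ : Field K) (f : F →+* K) (x : Fin m → K), (∀ i, x i ≠ 0) ∧
      (∀ n (d : Fin n → F), Aniso d → Aniso fun i => f (d i)) ∧
      ∀ n (d : Fin n → F) (p : Fin m → F), Aniso d → (∀ i, p i ≠ 0) →
        (∃ v, bil (fun i => f (d i)) v v = bil (fun i => f (p i)) x x) →
        m ≤ n ∧ Len (cls d - cls p) (n - m) := by
  induction m with
  | zero =>
    refine ⟨F, inferInstance, RingHom.id F, Fin.elim0, by simp, fun _ _ h => h,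
      fun n d p _ _ _ => ⟨n.zero_le, d, ?_⟩⟩
    simp [cls]
  | succ m ih =>
    obtain ⟨K, _, f, x, hx, hf, hsub⟩ := ih
    have := neZero_two_of_ringHom f
    refine ⟨FractionRing (Polynomial K), inferInstance, (toRat K).comp f,
      Fin.cons (algebraMap (Polynomial K) _ Polynomial.X) fun i => toRat K (x i), ?_,
      fun n d hd => (hf n d hd).toRat, ?_⟩
    · exact Fin.cases (by simp) (by simpa using hx)
    · rintro n d p hd hp ⟨v, hv⟩
      obtain ⟨u, w, hu, huw, hw⟩ := (hf n d hd).exists_orthogonal (p := f (p 0))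
        (a := bil (fun i => f (Fin.tail p i)) x x) (v := v) (by
          refine hv.trans ?_
          rw [bil_succ, map_bil]
          unfold Fin.tail
          simp
          ring)
      have hiso : ¬ Aniso (Fin.cons (-p 0) d : Fin (n + 1) → F) := by
        intro h
        have h1 := hf _ _ h (Fin.cons 1 w) (by
          rw [bil_succ]
          unfold Fin.tail
          simp [hw])
        simpa using congr_fun h1 0
      have hlen : Len (cls d - br (p 0)) n := by
        unfold Aniso at hiso
        push Not at hiso
        obtain ⟨z, hz, hz0⟩ := hiso
        obtain ⟨e, he⟩ := cls_eq_br_add _ hz0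
        refine ⟨e, ?_⟩
        rw [hz, br_zero, cls_cons, br_neg] at he
        linear_combination he
      obtain ⟨z, hz⟩ := hd.exists_bil_eq (hp 0) hlen le_rfl
      have hz0 : z ≠ 0 := by
        rintro rfl
        exact hp 0 (by rw [← hz, bil_zero_left])
      cases n with
      | zero => exact absurd (Subsingleton.elim _ _) hz0
      | succ n =>
        obtain ⟨d', hd'⟩ := cls_eq_br_add d hz0
        rw [hz] at hd'
        have had' := hd.of_cls_eq_add le_rfl hd'
        have hK : cls (fun i => f (d i)) = br (f (p 0)) + cls fun i => f (d' i) := by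
          rw [← bc_cls, ← bc_cls, ← bc_br, hd', map_add]
        obtain ⟨u', hu'⟩ := exists_bil_eq_of_orthogonal (hf _ _ hd).ne_zero (hf _ _ had').ne_zero
          (by simpa using hp 0) hK hw huw
        obtain ⟨hmn, hlen'⟩ := hsub n d' (Fin.tail p) had' (fun i => hp _) ⟨u', hu'.trans hu⟩
        refine ⟨by omega, ?_⟩
        rw [hd', cls_succ p, add_sub_add_left_eq_sub, Nat.add_sub_add_right]
        exact hlen'

end Generic

section QuadraticExtension

variable {F : Type u} [Field F]

lemma br_mul_one_sub_br {x : F} (hx : x ≠ 0) (δ : F) :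
    br (x ^ 2 - δ) * (1 - br δ) = 1 - br δ := by
  have h := br_add_br (x ^ 2) (-δ)
  have h1 := br_mul_sq 1 hx
  have h2 := br_mul_sq (-δ) hx
  rw [one_mul, br_one] at h1
  rw [h1, mul_comm (x ^ 2) (-δ), h2, br_neg, ← sub_eq_add_neg, ← sub_eq_add_neg] at h
  exact h.symm

variable [NeZero (2 : F)]

/-- The kernel of the base change to a quadratic extension `F(√δ)` is generated by `1 - br δ`. -/
lemma exists_eq_mul_of_bc_eq_zero {L : Type u} [Field L] (f : F →+* L) {δ : F} {t : L}
    (ht : t ^ 2 = f δ) (hspan : ∀ z, ∃ a b, z = f a + f b * t)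
    (hind : ∀ a b, f a + f b * t = 0 → a = 0 ∧ b = 0) {x : W F} (hx : bc f x = 0) :
    ∃ y, x = (1 - br δ) * y := by
  have := neZero_two_of_ringHom f
  have ht0 : t ≠ 0 := by
    rintro rfl
    simpa using (hind 0 1 (by simp)).2
  have hδ : δ ≠ 0 := by
    rintro rfl
    exact ht0 (by simpa using ht)
  have hker : bc f (1 - br δ) = 0 := by
    rw [map_sub, map_one, bc_br, ← ht, ← one_mul (t ^ 2), br_mul_sq _ ht0, br_one, sub_self]
  obtain ⟨n, hn⟩ : ∃ n, Len x n := exists_cls_eq x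
  induction n using Nat.strong_induction_on generalizing x with
  | _ n ih =>
    obtain ⟨k, d, hd, rfl⟩ := exists_aniso x
    have hk := hd.le_of_len hn
    cases k with
    | zero => exact ⟨0, by simp [cls]⟩
    | succ k =>
      rw [bc_cls] at hx
      obtain ⟨v, hv, hv0⟩ := isotropic_of_cls_eq (e := (Fin.elim0 : Fin 0 → L))
        (by simpa using hd.ne_zero) (by simp) (hx.trans (by simp [cls]))
      choose u w huw using fun i => hspan (v i)
      have hv' : v = (fun i => f (u i)) + t • fun i => f (w i) :=
        funext fun i => by simp [huw i, mul_comm]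
      rw [hv'] at hv0
      simp only [bil_add_left, bil_add_right, bil_smul_left, bil_smul_right] at hv0
      rw [bil_comm _ (fun i => f (w i)) fun i => f (u i), ← map_bil, ← map_bil, ← map_bil] at hv0
      obtain ⟨h1, h2⟩ := hind (bil d u u + δ * bil d w w) (2 * bil d u w) (by
        rw [map_add, map_mul, map_mul, ← ht, map_ofNat]
        linear_combination hv0)
      have huw0 : bil d u w = 0 := by simpa [NeZero.ne (2 : F)] using h2
      have hc : bil d w w ≠ 0 := by
        intro hc
        have hw0 := hd w hc
        rw [hc, mul_zero, add_zero] at h1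
        have hu0 := hd u h1
        exact hv (by rw [hv', hw0, hu0]; ext; simp)
      have hw0 : w ≠ 0 := by
        rintro rfl
        exact hc (bil_zero_left _ _)
      obtain ⟨d', hd'⟩ := cls_eq_br_add d hw0
      have had' := hd.of_cls_eq_add le_rfl hd'
      obtain ⟨u', hu'⟩ :=
        exists_bil_eq_of_orthogonal hd.ne_zero had'.ne_zero hc hd' rfl huw0
      have hu'' : bil d' u' u' = -(δ * bil d w w) := by linear_combination hu' + h1
      have hu0 : u' ≠ 0 := by
        rintro rfl
        rw [bil_zero_left] at hu''
        exact mul_ne_zero hδ hc (by linear_combination hu'')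
      cases k with
      | zero => exact absurd (Subsingleton.elim _ _) hu0
      | succ k =>
        obtain ⟨d'', hd''⟩ := cls_eq_br_add d' hu0
        rw [hu'', br_neg, br_mul] at hd''
        have hsum : cls d = (1 - br δ) * br (bil d w w) + cls d'' := by
          rw [hd', hd'']; ring
        obtain ⟨y, hy⟩ := ih k (by omega) (x := cls d'') (by
          have h3 := congr_arg (bc f) hsum
          rwa [map_add, map_mul, hker, zero_mul, zero_add, bc_cls, hx, eq_comm] at h3) ⟨d'', rfl⟩
        exact ⟨br (bil d w w) + y, by rw [hsum, hy]; ring⟩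

/-- Passing to the function field of an anisotropic form `p` representing `1`: forms that become
trivial there contain `p` up to a scalar. -/
lemma exists_isotropic_extension {m : ℕ} (hm : 1 ≤ m) {p : Fin (m + 1) → F} (hp : Aniso p)
    (hp0 : p 0 = 1) :
    ∃ (L : Type u) (_ : Field L) (g : F →+* L),
      (∃ v, v ≠ 0 ∧ bil (fun i => g (p i)) v v = 0) ∧
      ∀ n (d : Fin (n + 1) → F), Aniso d → bc g (cls d) = 0 →
        m ≤ n ∧ Len (cls d - br (d 0) * cls p) (n - m) := by
  obtain ⟨K, _, f, x, hx, hf, hsub⟩ := exists_generic F (m + 1)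
  have := neZero_two_of_ringHom f
  have hpK := hf _ _ hp
  set pK : Fin (m + 1) → K := fun i => f (p i) with hpK'
  have hpK0 : pK 0 = 1 := by simp [hpK', hp0]
  have htail : Fin.tail x ≠ 0 := fun h => hx (Fin.succ ⟨0, hm⟩) (congr_fun h ⟨0, hm⟩)
  have hxne : x ≠ 0 := fun h => hx 0 (congr_fun h 0)
  set δ := x 0 ^ 2 - bil pK x x with hδ
  have hbil : ∀ y : K, bil pK (Fin.cons y (Fin.tail x)) (Fin.cons y (Fin.tail x)) = y ^ 2 - δ := by
    intro y
    rw [hδ, bil_succ, bil_succ pK x, hpK0]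
    simp
    ring
  have hsq : ∀ y, y ^ 2 ≠ δ := by
    intro y hy
    refine htail ?_
    have h1 := hpK (Fin.cons y (Fin.tail x)) (by rw [hbil, hy, sub_self])
    have h2 := congr_arg Fin.tail h1
    rwa [Fin.tail_cons] at h2
  let q : Polynomial K := Polynomial.X ^ 2 - Polynomial.C δ
  have hqm : q.Monic := Polynomial.monic_X_pow_sub_C δ two_ne_zero
  have : Fact (Irreducible q) := ⟨X_pow_sub_C_irreducible_of_prime Nat.prime_two hsq⟩
  let t : AdjoinRoot q := AdjoinRoot.root q
  have ht : t ^ 2 = AdjoinRoot.of q δ := by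
    have h1 := AdjoinRoot.eval₂_root q
    simpa [q, sub_eq_zero] using h1
  have hspan : ∀ z, ∃ a b, z = AdjoinRoot.of q a + AdjoinRoot.of q b * t := by
    intro z
    obtain ⟨r, rfl⟩ := AdjoinRoot.mk_surjective z
    have h1 : AdjoinRoot.mk q r = AdjoinRoot.mk q (r %ₘ q) := by
      conv_lhs => rw [← Polynomial.modByMonic_add_div r q]
      simp
    have h2 : (r %ₘ q).natDegree ≤ 1 := by
      have h3 := Polynomial.natDegree_modByMonic_lt r hqm (Irreducible.ne_one Fact.out)
      have h4 : q.natDegree = 2 := Polynomial.natDegree_X_pow_sub_C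
      omega
    refine ⟨(r %ₘ q).coeff 0, (r %ₘ q).coeff 1, ?_⟩
    rw [h1, Polynomial.eq_X_add_C_of_natDegree_le_one h2]
    simp [t, add_comm]
  have hind : ∀ a b, AdjoinRoot.of q a + AdjoinRoot.of q b * t = 0 → a = 0 ∧ b = 0 := by
    intro a b hab
    by_cases hb : b = 0
    · simpa [hb] using hab
    · refine absurd ((AdjoinRoot.of q).injective ?_) (hsq (-a / b))
      have hb' : AdjoinRoot.of q b ≠ 0 := by simpa using hb
      rw [← ht, map_pow, map_div₀, map_neg]
      congr 1
      field_simp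
      linear_combination -hab
  refine ⟨AdjoinRoot q, inferInstance, (AdjoinRoot.of q).comp f,
    ⟨Fin.cons t fun i => AdjoinRoot.of q (Fin.tail x i), ?_, ?_⟩, ?_⟩
  · intro h
    refine htail (funext fun i => (AdjoinRoot.of q).injective ?_)
    simpa using congr_fun h i.succ
  · have h1 := congr_arg (AdjoinRoot.of q) (hbil 0)
    rw [map_bil, map_sub, ← ht] at h1
    rw [bil_succ] at h1 ⊢
    unfold Fin.tail at h1 ⊢
    simp [hp0] at h1 ⊢
    linear_combination h1
  · intro n d hd h0
    rw [← bc_comp] at h0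
    obtain ⟨y, hy⟩ := exists_eq_mul_of_bc_eq_zero (AdjoinRoot.of q) ht hspan hind h0
    have hs : br (bil pK x x) * bc f (cls d) = bc f (cls d) := by
      have h1 := br_mul_one_sub_br (hx 0) δ
      rw [hδ, sub_sub_cancel, ← hδ] at h1
      rw [hy, ← mul_assoc, h1]
    have hs0 : bil pK x x ≠ 0 := fun h => hxne (hpK x h)
    have hdK := hf _ _ hd
    have hlen : Len (cls (fun i => f (d i)) - br (bil pK x x * f (d 0))) n := by
      refine ⟨fun i => bil pK x x * f (d i.succ), ?_⟩
      rw [cls_smul, br_mul, ← bc_cls, ← hs, bc_cls, cls_succ]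
      unfold Fin.tail
      ring
    obtain ⟨v, hv⟩ := hdK.exists_bil_eq (mul_ne_zero hs0 (by simpa using hd.ne_zero 0)) hlen
      n.le_succ
    obtain ⟨hle, hlen'⟩ := hsub _ d (fun i => d 0 * p i) hd
      (fun i => mul_ne_zero (hd.ne_zero 0) (hp.ne_zero i)) ⟨v, by
        rw [hv]
        simp only [bil, map_mul, Finset.sum_mul, hpK']
        exact Finset.sum_congr rfl fun i _ => by ring⟩
    rw [cls_smul, Nat.add_sub_add_right] at hlen'
    exact ⟨by omega, hlen'⟩

end QuadraticExtension

section Pfister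

variable {F : Type u} [Field F] {n : ℕ}

/-- The Witt class of the Pfister form `⟨1, a 0⟩ ⊗ ⋯ ⊗ ⟨1, a (n - 1)⟩`. -/
noncomputable def pf (a : Fin n → F) : W F := ∏ j, (1 + br (a j))

lemma pf_cons (c : F) (a : Fin n → F) :
    pf (Fin.cons c a : Fin (n + 1) → F) = (1 + br c) * pf a := by
  simp [pf, Fin.prod_univ_succ]

lemma bc_pf {K : Type u} [Field K] (f : F →+* K) (a : Fin n → F) :
    bc f (pf a) = pf fun j => f (a j) := by
  simp only [pf, map_prod, map_add, map_one, bc_br]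

lemma cls_pfisterOf (a : Fin n → F) : cls (QF.pfisterOf a) = pf a := by
  let φ : F →* W F := ⟨⟨br, br_one⟩, br_mul⟩
  have h1 : ∀ j, 1 + br (a j) = ∑ b : Fin 2, br (if b = 0 then 1 else a j) := by
    simp [Fin.sum_univ_two]
  simp only [pf, h1]
  rw [Finset.prod_univ_sum, Fintype.piFinset_univ, cls,
    ← Equiv.sum_comp (finFunctionFinEquiv (m := 2) (n := n))]
  refine Finset.sum_congr rfl fun s _ => ?_
  rw [QF.pfisterOf, Equiv.symm_apply_apply]
  exact map_prod φ _ _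

/-- Pfister forms are round. -/
lemma exists_round_form (a : Fin n → F) (ha : ∀ j, a j ≠ 0) :
    ∃ (m : ℕ) (e : Fin (m + 1) → F), m + 1 = 2 ^ n ∧ e 0 = 1 ∧ cls e = pf a ∧
      ∀ v, v ≠ 0 → br (bil e v v) * pf a = pf a := by
  induction n with
  | zero =>
    refine ⟨0, fun _ => 1, rfl, rfl, by simp [cls, pf], fun v hv => ?_⟩
    have h0 : v 0 ≠ 0 := fun h => hv (funext fun i => by rw [Fin.fin_one_eq_zero i, h]; rfl)
    simp [bil, br_mul, br_sq h0]
  | succ n ih =>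
    obtain ⟨m, e, hm, he0, he, hround⟩ := ih (Fin.tail a) fun j => ha j.succ
    have hpf : pf a = (1 + br (a 0)) * pf (Fin.tail a) := by
      rw [← pf_cons, Fin.cons_self_tail]
    refine ⟨m + 1 + m, (Fin.append e fun i => a 0 * e i : Fin ((m + 1) + (m + 1)) → F), by omega,
      ?_, ?_, fun v hv => ?_⟩
    · exact (Fin.append_left e (fun i => a 0 * e i) 0).trans he0
    · refine (cls_append e fun i => a 0 * e i).trans ?_
      rw [cls_smul, he, hpf]
      ring
    · obtain ⟨v₁, v₂, rfl⟩ : ∃ v₁ v₂ : Fin (m + 1) → F, v = Fin.append v₁ v₂ :=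
        ⟨_, _, (Fin.append_castAdd_natAdd (m := m + 1) (n := m + 1) (f := v)).symm⟩
      have hb : bil (Fin.append e fun i => a 0 * e i) (Fin.append v₁ v₂) (Fin.append v₁ v₂) =
          bil e v₁ v₁ + a 0 * bil e v₂ v₂ := by
        rw [bil_append]
        simp only [bil, Finset.mul_sum, mul_assoc]
      have hb' := congr_arg (br · * pf a) hb
      refine hb'.trans ?_
      simp only [hpf]
      by_cases h₂ : v₂ = 0
      · have h₁ : v₁ ≠ 0 := by
          rintro rfl
          refine hv (funext fun i => ?_)
          rw [h₂]
          exact Fin.addCases (m := m + 1) (n := m + 1) (fun i => Fin.append_left _ _ i)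
            (fun i => Fin.append_right _ _ i) i
        rw [h₂, bil_zero_left, mul_zero, add_zero]
        linear_combination (1 + br (a 0)) * hround v₁ h₁
      · by_cases h₁ : v₁ = 0
        · rw [h₁, bil_zero_left, zero_add, br_mul]
          linear_combination br (a 0) * (1 + br (a 0)) * hround v₂ h₂ +
            br_sq (ha 0) * pf (Fin.tail a)
        · have h3 := br_add_br (bil e v₁ v₁) (a 0 * bil e v₂ v₂)
          have h4 := hround v₁ h₁
          have h5 := hround v₂ h₂
          rw [br_mul, br_mul, br_mul (a 0)] at h3
          set s := br (bil e v₁ v₁ + a 0 * bil e v₂ v₂)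
          linear_combination -pf (Fin.tail a) * h3 + (1 - s * br (a 0) * br (bil e v₂ v₂)) * h4
            + (br (a 0) - s * br (a 0)) * h5

lemma len_of_isotropic {m : ℕ} {d : Fin (m + 1) → F} (h : ¬ Aniso d) : Len (cls d) m := by
  unfold Aniso at h
  push Not at h
  obtain ⟨v, hv, hv0⟩ := h
  obtain ⟨e, he⟩ := cls_eq_br_add d hv0
  exact ⟨e, by rw [he, hv, br_zero, zero_add]⟩

/-- Elements of the Witt ring that are sums of `r` scaled classes of `n`-fold Pfister forms. -/
inductive PSum (F : Type u) [Field F] (n : ℕ) : ℕ → W F → Prop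
  | zero : PSum F n 0 0
  | add {r : ℕ} {x : W F} (c : F) (a : Fin n → F) :
      (∀ j, a j ≠ 0) → PSum F n r x → PSum F n (r + 1) (x + br c * pf a)

lemma PSum.baseChange {K : Type u} [Field K] (f : F →+* K) {r : ℕ} {x : W F} (hx : PSum F n r x) :
    PSum K n r (bc f x) := by
  induction hx with
  | zero => simpa using PSum.zero
  | add c a ha _ ih =>
    rw [map_add, map_mul, bc_br, bc_pf]
    exact ih.add _ _ fun j => by simpa using ha j

lemma PSum.smul {r : ℕ} {x : W F} (hx : PSum F n r x) (b : F) : PSum F n r (br b * x) := by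
  induction hx with
  | zero => simpa using PSum.zero
  | add c a ha _ ih =>
    rw [mul_add, ← mul_assoc, ← br_mul]
    exact ih.add _ a ha

variable [NeZero (2 : F)]

/-- Isotropic Pfister forms are hyperbolic. -/
lemma pf_eq_zero_of_len {a : Fin n → F} (ha : ∀ j, a j ≠ 0) {k : ℕ} (h : Len (pf a) k)
    (hk : k < 2 ^ n) : pf a = 0 := by
  obtain ⟨m, e, hm, -, he, hround⟩ := exists_round_form a ha
  by_cases hani : Aniso e
  · have := hani.le_of_len (he ▸ h)
    omega
  · unfold Aniso at hani
    push Not at hani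
    obtain ⟨v, hv, hv0⟩ := hani
    rw [← hround v hv0, hv, br_zero, zero_mul]

end Pfister

section Hauptsatz

lemma bc_pf_eq_zero {F K : Type u} [Field F] [Field K] [NeZero (2 : K)] (g : F →+* K) {n : ℕ}
    {a : Fin n → F} (ha : ∀ j, a j ≠ 0) {m : ℕ} {e : Fin (m + 1) → F} (he : cls e = pf a)
    (hm : m + 1 = 2 ^ n)
    {v : Fin (m + 1) → K} (hv0 : v ≠ 0) (hv : bil (g ∘ e) v v = 0) : bc g (pf a) = 0 := by
  rw [bc_pf]
  refine pf_eq_zero_of_len (k := m) (fun j => by simpa using ha j) ?_ (by omega)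
  rw [← bc_pf, ← he, bc_cls]
  exact len_of_isotropic fun h => hv0 (h v hv)

/-- The Arason–Pfister Hauptsatz for Witt classes. -/
lemma PSum.eq_zero_of_len {n r : ℕ} (hn : 1 ≤ n) {F : Type u} [Field F] [NeZero (2 : F)]
    {x : W F} (hx : PSum F n r x) {k : ℕ} (hk : Len x k) (hkn : k < 2 ^ n) : x = 0 := by
  induction r generalizing F k with
  | zero =>
    cases hx
    rfl
  | succ r ih =>
    cases hx with
    | @add _ y c a ha hy =>
      obtain ⟨m, e, hm, he0, he, -⟩ := exists_round_form a ha
      by_cases hani : Aniso e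
      · have h2n : 2 ^ 1 ≤ 2 ^ n := Nat.pow_le_pow_right two_pos hn
        obtain ⟨L, _, g, ⟨v, hv0, hv⟩, hsub⟩ := exists_isotropic_extension (by omega) hani he0
        have := neZero_two_of_ringHom g
        have hpf : bc g (pf a) = 0 := bc_pf_eq_zero g ha he hm hv0 hv
        have hxy : bc g (y + br c * pf a) = bc g y := by
          rw [map_add, map_mul, hpf, mul_zero, add_zero]
        have hzero : bc g (y + br c * pf a) = 0 := by
          rw [hxy]
          exact ih (hy.baseChange g) (hxy ▸ hk.bc g) hkn
        obtain ⟨l, d, hd, hxd⟩ := exists_aniso (y + br c * pf a)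
        rw [hxd] at hk hzero ⊢
        have hl := hd.le_of_len hk
        cases l with
        | zero => simp [cls]
        | succ l =>
          have := (hsub l d hd hzero).1
          omega
      · have hpf := pf_eq_zero_of_len ha (he ▸ len_of_isotropic hani) (by omega)
        rw [hpf, mul_zero, add_zero] at hk ⊢
        exact ih hy hk hkn

variable {F : Type u} [Field F] [NeZero (2 : F)]

/-- A class of `Iⁿ` of length exactly `2 ^ n` representing `1` agrees with the class of a `k`-fold
Pfister form up to a form of dimension `2 ^ n - 2 ^ k`. -/
lemma PSum.exists_len_sub_pf {n r : ℕ} {x : W F} (hx : PSum F n r x)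
    (hmin : ∀ k, Len x k → 2 ^ n ≤ k) (h1 : Len (x - 1) (2 ^ n - 1)) {k : ℕ} (hkn : k ≤ n) :
    ∃ a : Fin k → F, (∀ j, a j ≠ 0) ∧ Len (x - pf a) (2 ^ n - 2 ^ k) := by
  induction k with
  | zero => exact ⟨Fin.elim0, by simp, by simpa [pf] using h1⟩
  | succ k ih =>
    obtain ⟨a, ha, hrest⟩ := ih (by omega)
    obtain ⟨m, e, hm, he0, he, -⟩ := exists_round_form a ha
    have hpow : 2 ^ (k + 1) ≤ 2 ^ n := Nat.pow_le_pow_right two_pos hkn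
    rw [pow_succ] at hpow
    have hpos : 0 < 2 ^ k := by positivity
    obtain ⟨j, hj⟩ : ∃ j, 2 ^ n - 2 ^ k = j + 1 := ⟨2 ^ n - 2 ^ k - 1, by omega⟩
    rw [hj] at hrest
    obtain ⟨τ, hτ⟩ := hrest
    have hlen : ∀ {i j}, Len (pf a) i → Len (cls τ) j → 2 ^ n ≤ i + j := by
      intro i j hi hj
      refine hmin _ ?_
      have := hi.add hj
      rwa [← hτ, add_sub_cancel] at this
    have hpflen : Len (pf a) (2 ^ k) := ⟨fun i => e (i.cast hm.symm), by
      rw [← he]; exact (Equiv.sum_comp (finCongr hm.symm) fun i => br (e i)).symm⟩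
    have hτani : Aniso τ := aniso_of_le_len fun j hj => by
      have := hlen hpflen hj
      omega
    have heani : Aniso e := by
      by_contra h
      have := hlen (he ▸ len_of_isotropic h) ⟨τ, rfl⟩
      omega
    refine ⟨Fin.cons (τ 0) a, Fin.cases (hτani.ne_zero 0) ha, ?_⟩
    have hsplit : x - pf (Fin.cons (τ 0) a : Fin (k + 1) → F) = cls τ - br (τ 0) * cls e := by
      rw [pf_cons, he, ← hτ]
      ring
    have htarget : 2 ^ n - 2 ^ (k + 1) = j - m := by
      rw [pow_succ]
      omega
    rw [hsplit, htarget]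
    by_cases hm0 : m = 0
    · subst hm0
      refine ⟨Fin.tail τ, ?_⟩
      rw [cls_succ, cls_succ e, he0]
      simp [cls]
    · obtain ⟨L, _, g, ⟨v, hv0, hv⟩, hsub⟩ :=
        exists_isotropic_extension (Nat.one_le_iff_ne_zero.2 hm0) heani he0
      have := neZero_two_of_ringHom g
      have hpf : bc g (pf a) = 0 := bc_pf_eq_zero g ha he hm hv0 hv
      have hxτ : bc g x = bc g (cls τ) := by
        rw [← hτ, map_sub, hpf, sub_zero]
      have hlenx : Len (bc g x) (j + 1) := hxτ ▸ Len.bc g ⟨τ, rfl⟩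
      have hx0 : bc g x = 0 := (hx.baseChange g).eq_zero_of_len (by omega) hlenx (by omega)
      exact (hsub j τ hτani (hxτ ▸ hx0)).2

/-- A class of `Iⁿ` of dimension `2 ^ n` is a scalar multiple of the class of a Pfister form. -/
lemma PSum.exists_eq_br_mul_pf {n r : ℕ} (hn : 1 ≤ n) {q : Fin (2 ^ n) → F}
    (hx : PSum F n r (cls q)) :
    ∃ c ≠ 0, ∃ a : Fin n → F, (∀ j, a j ≠ 0) ∧ cls q = br c * pf a := by
  obtain ⟨m, hm⟩ : ∃ m, 2 ^ n = m + 1 := ⟨2 ^ n - 1, by have := Nat.two_pow_pos n; omega⟩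
  obtain ⟨d, hd⟩ : ∃ d : Fin (m + 1) → F, cls q = cls d :=
    ⟨q ∘ finCongr hm.symm, (cls_comp_equiv q (finCongr hm.symm)).symm⟩
  rw [hd] at hx ⊢
  by_cases hani : Aniso d
  · have h0 := hani.ne_zero 0
    have hy := hx.smul (d 0)
    have hmin : ∀ k, Len (br (d 0) * cls d) k → 2 ^ n ≤ k := by
      intro k hk
      have := hk.br_mul (d 0)
      rw [← mul_assoc, br_sq h0, one_mul] at this
      exact hm ▸ hani.le_of_len this
    have h1 : Len (br (d 0) * cls d - 1) (2 ^ n - 1) := by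
      rw [hm, Nat.add_sub_cancel, cls_succ, mul_add, br_sq h0, add_sub_cancel_left]
      exact Len.br_mul ⟨_, rfl⟩ _
    obtain ⟨a, ha, hlen⟩ := hy.exists_len_sub_pf hmin h1 le_rfl
    rw [Nat.sub_self, len_zero_iff, sub_eq_zero] at hlen
    exact ⟨d 0, h0, a, ha, by rw [← hlen, ← mul_assoc, br_sq h0, one_mul]⟩
  · refine ⟨1, one_ne_zero, fun _ => -1, by simp, ?_⟩
    rw [hx.eq_zero_of_len hn (len_of_isotropic hani) (by omega)]
    simp [pf, br_neg_one, Nat.one_le_iff_ne_zero.1 hn]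

end Hauptsatz

section Bridge

variable {F : Type u} [Field F] {m n k : ℕ}

lemma evalQF_eq_bil (d v : Fin n → F) : QF.evalQF d v = bil d v v := by
  simp only [QF.evalQF, bil, sq, mul_assoc]

lemma Iso.isometric {d : Fin m → F} {e : Fin n → F} (h : Iso d e) : QF.Isometric d e := by
  obtain ⟨φ, hφ⟩ := h
  exact ⟨φ, fun v => by rw [evalQF_eq_bil, evalQF_eq_bil, hφ]⟩

lemma append_ne_zero {d : Fin m → F} {e : Fin n → F} (hd : ∀ i, d i ≠ 0) (he : ∀ i, e i ≠ 0)
    (i : Fin (m + n)) : Fin.append d e i ≠ 0 := by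
  refine Fin.addCases (fun i => ?_) (fun i => ?_) i
  · simpa using hd i
  · simpa using he i

lemma hypform_ne_zero (i : Fin (k + k)) : QF.hypform (R := F) k i ≠ 0 :=
  append_ne_zero (by simp) (by simp) i

lemma cls_hypform : cls (QF.hypform (R := F) k) = 0 := by
  rw [QF.hypform, cls_append]
  simp [cls, br_neg_one]

lemma pfisterOf_ne_zero {a : Fin n → F} (ha : ∀ j, a j ≠ 0) (i : Fin (2 ^ n)) :
    QF.pfisterOf a i ≠ 0 := by
  refine Finset.prod_ne_zero_iff.2 fun j _ => ?_
  split_ifs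
  · exact one_ne_zero
  · exact ha j

variable [NeZero (2 : F)]

lemma iso_of_isometric {d : Fin m → F} {e : Fin n → F} (h : QF.Isometric d e) : Iso d e := by
  obtain ⟨φ, hφ⟩ := h
  exact ⟨φ, polar_preserved φ.toLinearMap fun v => by
    rw [← evalQF_eq_bil, ← evalQF_eq_bil]; exact hφ v⟩

lemma exists_cls_eq_pf {π : Fin m → F} (h : QF.IsNPfister n π) :
    (∀ i, π i ≠ 0) ∧ ∃ a : Fin n → F, (∀ j, a j ≠ 0) ∧ cls π = pf a := by
  obtain ⟨a, ha, h⟩ := h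
  have h := iso_of_isometric h
  exact ⟨h.ne_zero (pfisterOf_ne_zero ha), a, ha, by
    rw [cls_eq_of_iso (pfisterOf_ne_zero ha) h, cls_pfisterOf]⟩

lemma pSum_cls {s : Fin m → F} (h : QF.IsPfisterSum F n s) :
    (∀ i, s i ≠ 0) ∧ ∃ r, PSum F n r (cls s) := by
  induction h with
  | nil => exact ⟨fun i => i.elim0, 0, by simpa [cls] using PSum.zero⟩
  | pos _ hπ ih =>
    obtain ⟨hd, r, hr⟩ := ih
    obtain ⟨hπ, a, ha, hpf⟩ := exists_cls_eq_pf hπ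
    refine ⟨append_ne_zero hd hπ, r + 1, ?_⟩
    rw [QF.osum, cls_append, hpf]
    simpa using hr.add 1 a ha
  | neg _ hπ ih =>
    obtain ⟨hd, r, hr⟩ := ih
    obtain ⟨hπ, a, ha, hpf⟩ := exists_cls_eq_pf hπ
    refine ⟨append_ne_zero hd fun i => mul_ne_zero (by simp) (hπ i), r + 1, ?_⟩
    have h := hr.add (-1) a ha
    rwa [← hpf, ← cls_smul, ← cls_append] at h

lemma cls_eq_of_wittEquiv {d : Fin m → F} {e : Fin n → F} (he : ∀ i, e i ≠ 0)
    (h : QF.WittEquiv d e) : cls d = cls e := by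
  obtain ⟨k, l, h⟩ := h
  have h := cls_eq_of_iso (append_ne_zero he hypform_ne_zero) (iso_of_isometric h)
  simpa [QF.osum, cls_append, cls_hypform] using h

lemma isHyperbolic_of_cls_eq_zero {d : Fin n → F} (hd : ∀ i, d i ≠ 0) (h : cls d = 0) :
    QF.IsHyperbolic d := by
  obtain ⟨j, rfl⟩ : ∃ j, n = j + j := by
    lift d to Fin n → Fˣ using fun i => isUnit_iff_ne_zero.2 (hd i)
    obtain ⟨k, l, h⟩ := wEq_of_cls_eq (d := d) (e := (Fin.elim0 : Fin 0 → Fˣ))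
      (Eq.trans h (by simp [cls]))
    have h1 := h.card_eq
    simp only [Fintype.card_sum, Fintype.card_fin] at h1
    exact ⟨l - k, by omega⟩
  exact ⟨j, (iso_of_cls_eq hd hypform_ne_zero rfl (h.trans cls_hypform.symm)).isometric⟩

lemma exists_similar_pfister {r : ℕ} {q : Fin (2 ^ n) → F} (hq : ∀ i, q i ≠ 0)
    (h : PSum F n r (cls q)) :
    ∃ c : F, c ≠ 0 ∧ ∃ π : Fin (2 ^ n) → F,
      QF.IsNPfister n π ∧ QF.Isometric q (QF.smulQF c π) := by
  obtain ⟨c, hc, a, ha, hca⟩ : ∃ c ≠ 0, ∃ a : Fin n → F, (∀ j, a j ≠ 0) ∧ cls q = br c * pf a := by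
    cases n with
    | zero => exact ⟨q 0, hq 0, Fin.elim0, fun i => i.elim0, by simp [cls, pf]⟩
    | succ n => exact h.exists_eq_br_mul_pf (by omega)
  exact ⟨c, hc, QF.pfisterOf a, ⟨a, ha, (Iso.refl _).isometric⟩,
    (iso_of_cls_eq hq (fun i => mul_ne_zero hc (pfisterOf_ne_zero ha i)) rfl
      (by rw [hca, ← cls_pfisterOf, ← cls_smul])).isometric⟩

end Bridge

end ArasonPfister

open QF in
/-- The Arason–Pfister Hauptsatz: let `q` be a form over `F` (char `F ≠ 2`) whose Witt class
lies in `Iⁿ(F)` (i.e. `q` is Witt equivalent to a signed sum of `n`-fold Pfister forms).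
If `dim q < 2ⁿ` then `q` is hyperbolic, and if `dim q = 2ⁿ` then `q` is similar to an
`n`-fold Pfister form. -/
theorem stmt_18 {F : Type*} [Field F] (h2 : (2 : F) ≠ 0)
    {nq : ℕ} (n : ℕ) (q : Fin nq → F) (hq : Nondeg q) (hq0 : 0 < nq)
    (hmem : ∃ (m : ℕ) (s : Fin m → F), IsPfisterSum F n s ∧ WittEquiv q s) :
    (nq < 2 ^ n → IsHyperbolic q) ∧
    (nq = 2 ^ n → ∃ a : F, a ≠ 0 ∧
      ∃ π : Fin nq → F, IsNPfister n π ∧ Isometric q (smulQF a π)) := by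
  have : NeZero (2 : F) := ⟨h2⟩
  obtain ⟨m, s, hs, hqs⟩ := hmem
  obtain ⟨hs0, r, hr⟩ := ArasonPfister.pSum_cls hs
  rw [← ArasonPfister.cls_eq_of_wittEquiv hs0 hqs] at hr
  refine ⟨fun hlt => ?_, ?_⟩
  · have hn : 1 ≤ n := by
      by_contra! h0
      obtain rfl : n = 0 := by omega
      rw [pow_zero] at hlt
      omega
    exact ArasonPfister.isHyperbolic_of_cls_eq_zero hq (hr.eq_zero_of_len hn ⟨q, rfl⟩ hlt)
  · rintro rfl
    exact ArasonPfister.exists_similar_pfister hq hr
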